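/- arXiv:2402.02264 — 3 statements merged into one kernel-verified Lean document; each statement's English description precedes it below -/
import Mathlib

section
/- Let Z have the product-normal law PN(μ_X,μ_Y;σ_X²,σ_Y²;ρ). Then for every function f : ℝ → ℝ of class C⁴ such that E|f^{(m)}(Z)| < ∞ for m = 0,1,2,3 and E|Z·f^{(m)}(Z)| < ∞ for m = 0,1,2,3,4, one has E[A₁f(Z)] = 0, where A₁ is the fourth-order Stein operator with n = 1, i.e. (writing s = σ_Xσ_Y) A₁f(x) = s⁴(1−ρ²)²·x·f⁗(x) + s³(1−ρ²)(s(1−ρ²)+4ρx)·f‴(x) + s²(s(ρ(r_X²+r_Y²)−(1+ρ²)r_Xr_Y+3ρ(1−ρ²))+(6ρ²−2)x)·f″(x) + s(s(2ρ r_X r_Y−r_X²−r_Y²+3ρ²−1)−4ρx)·f′(x) + (x−μ_Xμ_Y−sρ)·f(x). -/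
open MeasureTheory ProbabilityTheory

/-- The product-normal law `PN(μX, μY; σX², σY²; ρ)`: the law of `X * Y` where
`X = μX + σX * U`, `Y = μY + σY * (ρ * U + √(1 - ρ²) * V)` and `U, V` are independent
standard normal random variables. -/
noncomputable def PN (μX μY σX σY ρ : ℝ) : Measure ℝ :=
  Measure.map
    (fun p : ℝ × ℝ =>
      (μX + σX * p.1) * (μY + σY * (ρ * p.1 + Real.sqrt (1 - ρ ^ 2) * p.2)))
    ((gaussianReal 0 1).prod (gaussianReal 0 1))

/-- The law of the mean `Z̄ₙ = n⁻¹ ∑ᵢ Zᵢ` of `n` independent random variables with law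
`PN(μX, μY; σX², σY²; ρ)`. -/
noncomputable def PNbar (n : ℕ) (μX μY σX σY ρ : ℝ) : Measure ℝ :=
  Measure.map (fun ω : Fin n → ℝ => (∑ i, ω i) / (n : ℝ))
    (Measure.pi fun _ : Fin n => PN μX μY σX σY ρ)

/-- The fourth-order Stein operator `A₁` (with `s_n = σXσY/n`, `r_X = μX/σX`, `r_Y = μY/σY`). -/
noncomputable def A1 (n : ℕ) (μX μY σX σY ρ : ℝ) (f : ℝ → ℝ) (x : ℝ) : ℝ :=
  (σX * σY / (n : ℝ)) ^ 4 * (1 - ρ ^ 2) ^ 2 * x * iteratedDeriv 4 f x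
    + (σX * σY / (n : ℝ)) ^ 3 * (1 - ρ ^ 2)
        * ((n : ℝ) * (σX * σY / (n : ℝ)) * (1 - ρ ^ 2) + 4 * ρ * x) * iteratedDeriv 3 f x
    + (σX * σY / (n : ℝ)) ^ 2
        * ((n : ℝ) * (σX * σY / (n : ℝ)) * (ρ * ((μX / σX) ^ 2 + (μY / σY) ^ 2)
              - (1 + ρ ^ 2) * (μX / σX) * (μY / σY) + 3 * ρ * (1 - ρ ^ 2))
            + (6 * ρ ^ 2 - 2) * x) * iteratedDeriv 2 f x
    + (σX * σY / (n : ℝ))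
        * ((n : ℝ) * (σX * σY / (n : ℝ)) * (2 * ρ * (μX / σX) * (μY / σY) - (μX / σX) ^ 2
              - (μY / σY) ^ 2 + 3 * ρ ^ 2 - 1) - 4 * ρ * x) * iteratedDeriv 1 f x
    + (x - μX * μY - (n : ℝ) * (σX * σY / (n : ℝ)) * ρ) * f x

/-- Stein's identity for the standard normal law. -/
lemma integral_id_mul_gaussianReal {h h' : ℝ → ℝ} (hd : ∀ x, HasDerivAt h (h' x) x)
    (hi : Integrable h (gaussianReal 0 1)) (hi' : Integrable h' (gaussianReal 0 1))
    (hxi : Integrable (fun x => x * h x) (gaussianReal 0 1)) :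
    ∫ x, x * h x ∂(gaussianReal 0 1) = ∫ x, h' x ∂(gaussianReal 0 1) := by
  have hiff : ∀ k : ℝ → ℝ, Integrable k (gaussianReal 0 1) ↔
      Integrable (fun x => gaussianPDFReal 0 1 x * k x) := by
    intro k
    rw [gaussianReal_of_var_ne_zero 0 one_ne_zero,
      integrable_withDensity_iff_integrable_smul' (measurable_gaussianPDF 0 1)
        (ae_of_all _ fun _ => gaussianPDF_lt_top)]
    simp only [toReal_gaussianPDF, smul_eq_mul]
  have hpdf : ∀ x, HasDerivAt (gaussianPDFReal 0 1) (-(gaussianPDFReal 0 1 x * x)) x := by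
    intro x
    have h1 : HasDerivAt (fun x : ℝ => -(x - 0) ^ 2 / (2 * ((1 : NNReal) : ℝ))) (-x) x := by
      have := ((((hasDerivAt_id x).sub_const 0).pow 2).neg).div_const (2 * ((1 : NNReal) : ℝ))
      refine this.congr_deriv ?_
      simp
      ring
    have h2 := (h1.exp).const_mul (√(2 * Real.pi * ((1 : NNReal) : ℝ)))⁻¹
    refine h2.congr_deriv ?_
    simp only [gaussianPDFReal]
    ring
  have key := integral_mul_deriv_eq_deriv_mul_of_integrable
    (u := h) (v := gaussianPDFReal 0 1) (u' := h')
    (v' := fun x => -(gaussianPDFReal 0 1 x * x)) (fun x _ => hd x) (fun x _ => hpdf x)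
    (by
      refine (((hiff _).1 hxi).neg).congr (ae_of_all _ fun x => ?_)
      change -(gaussianPDFReal 0 1 x * (x * h x)) = h x * -(gaussianPDFReal 0 1 x * x)
      ring)
    (by
      exact ((hiff _).1 hi').congr (ae_of_all _ fun x => mul_comm _ _))
    (by
      exact ((hiff _).1 hi).congr (ae_of_all _ fun x => mul_comm _ _))
  rw [integral_gaussianReal_eq_integral_smul one_ne_zero,
    integral_gaussianReal_eq_integral_smul one_ne_zero]
  have e1 : ∫ x, gaussianPDFReal 0 1 x • (x * h x)
      = -∫ x, h x * -(gaussianPDFReal 0 1 x * x) := by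
    rw [← integral_neg]
    congr 1
    ext x
    change _ * (x * h x) = _
    ring
  rw [e1, key, neg_neg]
  congr 1
  ext x
  exact mul_comm _ _

/-- Stein's identity in the first coordinate of a pair of independent standard normals. -/
lemma integral_fst_mul_gaussianReal_prod {h h' : ℝ × ℝ → ℝ}
    (hd : ∀ u v, HasDerivAt (fun t => h (t, v)) (h' (u, v)) u)
    (hi : Integrable h ((gaussianReal 0 1).prod (gaussianReal 0 1)))
    (hi' : Integrable h' ((gaussianReal 0 1).prod (gaussianReal 0 1)))
    (hxi : Integrable (fun p => p.1 * h p) ((gaussianReal 0 1).prod (gaussianReal 0 1))) :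
    ∫ p, p.1 * h p ∂((gaussianReal 0 1).prod (gaussianReal 0 1))
      = ∫ p, h' p ∂((gaussianReal 0 1).prod (gaussianReal 0 1)) := by
  rw [integral_prod_symm _ hxi, integral_prod_symm _ hi']
  refine integral_congr_ae ?_
  filter_upwards [hi.prod_left_ae, hi'.prod_left_ae, hxi.prod_left_ae] with v h1 h2 h3
  exact integral_id_mul_gaussianReal (fun u => hd u v) h1 h2 h3

/-- The affine function `(u, v) ↦ a + b u + c v` on the plane. -/
def planeAffine (a b c : ℝ) (p : ℝ × ℝ) : ℝ := a + b * p.1 + c * p.2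

lemma continuous_planeAffine (a b c : ℝ) : Continuous (planeAffine a b c) := by
  unfold planeAffine
  fun_prop

lemma memLp_planeAffine (a b c : ℝ) :
    MemLp (planeAffine a b c) 2 ((gaussianReal 0 1).prod (gaussianReal 0 1)) := by
  have h1 : MemLp (fun p : ℝ × ℝ => p.1) 2 ((gaussianReal 0 1).prod (gaussianReal 0 1)) :=
    (memLp_id_gaussianReal 2).comp_fst (gaussianReal 0 1)
  have h2 : MemLp (fun p : ℝ × ℝ => p.2) 2 ((gaussianReal 0 1).prod (gaussianReal 0 1)) :=
    (memLp_id_gaussianReal 2).comp_snd (gaussianReal 0 1)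
  exact ((memLp_const a).add (h1.const_mul b)).add (h2.const_mul c)

lemma integrable_planeAffine_mul_mul {G : ℝ × ℝ → ℝ} (hG : Continuous G)
    (hb : ∃ C, ∀ p, |G p| ≤ C) (a b c a' b' c' : ℝ) :
    Integrable (fun p => planeAffine a b c p * planeAffine a' b' c' p * G p)
      ((gaussianReal 0 1).prod (gaussianReal 0 1)) := by
  obtain ⟨C, hC⟩ := hb
  exact ((memLp_planeAffine a b c).integrable_mul (memLp_planeAffine a' b' c')).mul_bdd
    hG.aestronglyMeasurable (ae_of_all _ hC)

lemma integrable_planeAffine_mul {G : ℝ × ℝ → ℝ} (hG : Continuous G)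
    (hb : ∃ C, ∀ p, |G p| ≤ C) (a b c : ℝ) :
    Integrable (fun p => planeAffine a b c p * G p)
      ((gaussianReal 0 1).prod (gaussianReal 0 1)) := by
  obtain ⟨C, hC⟩ := hb
  exact ((memLp_planeAffine a b c).integrable one_le_two).mul_bdd
    hG.aestronglyMeasurable (ae_of_all _ hC)

lemma integrable_of_continuous_of_bounded {G : ℝ × ℝ → ℝ} (hG : Continuous G)
    (hb : ∃ C, ∀ p, |G p| ≤ C) :
    Integrable G ((gaussianReal 0 1).prod (gaussianReal 0 1)) := by
  obtain ⟨C, hC⟩ := hb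
  exact Integrable.of_bound hG.aestronglyMeasurable C (ae_of_all _ hC)

section AffineProduct

variable {g g' : ℝ → ℝ}

lemma integral_fst_mul_affine_mul_comp (hd : ∀ x, HasDerivAt g (g' x) x) (hg' : Continuous g')
    (hb : ∃ C, ∀ x, |g x| ≤ C) (hb' : ∃ C, ∀ x, |g' x| ≤ C)
    (p₀ p₁ p₂ x₀ x₁ x₂ y₀ y₁ y₂ : ℝ) :
    ∫ p, p.1 * (planeAffine p₀ p₁ p₂ p * g (planeAffine x₀ x₁ x₂ p * planeAffine y₀ y₁ y₂ p))
        ∂((gaussianReal 0 1).prod (gaussianReal 0 1))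
      = p₁ * (∫ p, g (planeAffine x₀ x₁ x₂ p * planeAffine y₀ y₁ y₂ p)
          ∂((gaussianReal 0 1).prod (gaussianReal 0 1)))
        + y₁ * (∫ p, planeAffine p₀ p₁ p₂ p * planeAffine x₀ x₁ x₂ p
            * g' (planeAffine x₀ x₁ x₂ p * planeAffine y₀ y₁ y₂ p)
          ∂((gaussianReal 0 1).prod (gaussianReal 0 1)))
        + x₁ * (∫ p, planeAffine p₀ p₁ p₂ p * planeAffine y₀ y₁ y₂ p
            * g' (planeAffine x₀ x₁ x₂ p * planeAffine y₀ y₁ y₂ p)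
          ∂((gaussianReal 0 1).prod (gaussianReal 0 1))) := by
  have hX := continuous_planeAffine x₀ x₁ x₂
  have hY := continuous_planeAffine y₀ y₁ y₂
  have hg : Continuous g := continuous_iff_continuousAt.2 fun x => (hd x).continuousAt
  have hG : Continuous fun p => g (planeAffine x₀ x₁ x₂ p * planeAffine y₀ y₁ y₂ p) :=
    hg.comp (hX.mul hY)
  have hG' : Continuous fun p => g' (planeAffine x₀ x₁ x₂ p * planeAffine y₀ y₁ y₂ p) :=
    hg'.comp (hX.mul hY)
  have hB : ∃ C, ∀ p, |g (planeAffine x₀ x₁ x₂ p * planeAffine y₀ y₁ y₂ p)| ≤ C :=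
    hb.imp fun C hC p => hC _
  have hB' : ∃ C, ∀ p, |g' (planeAffine x₀ x₁ x₂ p * planeAffine y₀ y₁ y₂ p)| ≤ C :=
    hb'.imp fun C hC p => hC _
  have i1 := (integrable_of_continuous_of_bounded hG hB).const_mul p₁
  have i2 := (integrable_planeAffine_mul_mul hG' hB' p₀ p₁ p₂ x₀ x₁ x₂).const_mul y₁
  have i3 := (integrable_planeAffine_mul_mul hG' hB' p₀ p₁ p₂ y₀ y₁ y₂).const_mul x₁
  rw [← integral_const_mul, ← integral_const_mul, ← integral_const_mul]
  refine Eq.trans (integral_fst_mul_gaussianReal_prod ?_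
    (integrable_planeAffine_mul hG hB p₀ p₁ p₂) ((i1.add i2).add i3) ?_) ?_
  · intro u v
    have hl : ∀ a b c : ℝ, HasDerivAt (fun t => planeAffine a b c (t, v)) b u := by
      intro a b c
      have := (((hasDerivAt_id u).const_mul b).const_add a).add_const (c * v)
      simpa [planeAffine] using this
    have h1 := (hl p₀ p₁ p₂).mul ((hd _).comp u ((hl x₀ x₁ x₂).mul (hl y₀ y₁ y₂)))
    refine h1.congr_deriv ?_
    simp only [Pi.add_apply, Function.comp_apply, Pi.mul_apply]
    ring
  · refine (integrable_planeAffine_mul_mul hG hB 0 1 0 p₀ p₁ p₂).congr (ae_of_all _ fun p => ?_)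
    simp only [show planeAffine 0 1 0 p = p.1 by simp [planeAffine], mul_assoc]
  · exact (integral_add (i1.add i2) i3).trans (congrArg₂ _ (integral_add i1 i2) rfl)

lemma integral_snd_mul_affine_mul_comp (hd : ∀ x, HasDerivAt g (g' x) x) (hg' : Continuous g')
    (hb : ∃ C, ∀ x, |g x| ≤ C) (hb' : ∃ C, ∀ x, |g' x| ≤ C)
    (p₀ p₁ p₂ x₀ x₁ x₂ y₀ y₁ y₂ : ℝ) :
    ∫ p, p.2 * (planeAffine p₀ p₁ p₂ p * g (planeAffine x₀ x₁ x₂ p * planeAffine y₀ y₁ y₂ p))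
        ∂((gaussianReal 0 1).prod (gaussianReal 0 1))
      = p₂ * (∫ p, g (planeAffine x₀ x₁ x₂ p * planeAffine y₀ y₁ y₂ p)
          ∂((gaussianReal 0 1).prod (gaussianReal 0 1)))
        + y₂ * (∫ p, planeAffine p₀ p₁ p₂ p * planeAffine x₀ x₁ x₂ p
            * g' (planeAffine x₀ x₁ x₂ p * planeAffine y₀ y₁ y₂ p)
          ∂((gaussianReal 0 1).prod (gaussianReal 0 1)))
        + x₂ * (∫ p, planeAffine p₀ p₁ p₂ p * planeAffine y₀ y₁ y₂ p
            * g' (planeAffine x₀ x₁ x₂ p * planeAffine y₀ y₁ y₂ p)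
          ∂((gaussianReal 0 1).prod (gaussianReal 0 1))) := by
  have hs : ∀ (a b c : ℝ) (p : ℝ × ℝ), planeAffine a b c p.swap = planeAffine a c b p := by
    intro a b c p
    simp only [planeAffine, Prod.fst_swap, Prod.snd_swap]
    ring
  have key := integral_fst_mul_affine_mul_comp hd hg' hb hb' p₀ p₂ p₁ x₀ x₂ x₁ y₀ y₂ y₁
  have hsw : ∀ k : ℝ × ℝ → ℝ, ∫ p, k p ∂((gaussianReal 0 1).prod (gaussianReal 0 1))
      = ∫ p, k p.swap ∂((gaussianReal 0 1).prod (gaussianReal 0 1)) :=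
    fun k => (integral_prod_swap k).symm
  rw [hsw]
  rw [hsw fun p => g _, hsw fun p => _ * planeAffine x₀ x₁ x₂ p * g' _,
    hsw fun p => _ * planeAffine y₀ y₁ y₂ p * g' _]
  simp only [hs, Prod.snd_swap]
  exact key

/-- Gaussian integration by parts against an affine function, for functions of the form
`P * g (X * Y)` with `P`, `X`, `Y` affine. -/
lemma integral_affine_mul_affine_mul_comp (hd : ∀ x, HasDerivAt g (g' x) x)
    (hg' : Continuous g') (hb : ∃ C, ∀ x, |g x| ≤ C) (hb' : ∃ C, ∀ x, |g' x| ≤ C)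
    (l₀ l₁ l₂ p₀ p₁ p₂ x₀ x₁ x₂ y₀ y₁ y₂ : ℝ) :
    ∫ p, planeAffine l₀ l₁ l₂ p * planeAffine p₀ p₁ p₂ p
          * g (planeAffine x₀ x₁ x₂ p * planeAffine y₀ y₁ y₂ p)
        ∂((gaussianReal 0 1).prod (gaussianReal 0 1))
      = l₀ * (∫ p, planeAffine p₀ p₁ p₂ p
            * g (planeAffine x₀ x₁ x₂ p * planeAffine y₀ y₁ y₂ p)
          ∂((gaussianReal 0 1).prod (gaussianReal 0 1)))
        + (l₁ * p₁ + l₂ * p₂) * (∫ p, g (planeAffine x₀ x₁ x₂ p * planeAffine y₀ y₁ y₂ p)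
          ∂((gaussianReal 0 1).prod (gaussianReal 0 1)))
        + (l₁ * y₁ + l₂ * y₂) * (∫ p, planeAffine p₀ p₁ p₂ p * planeAffine x₀ x₁ x₂ p
            * g' (planeAffine x₀ x₁ x₂ p * planeAffine y₀ y₁ y₂ p)
          ∂((gaussianReal 0 1).prod (gaussianReal 0 1)))
        + (l₁ * x₁ + l₂ * x₂) * (∫ p, planeAffine p₀ p₁ p₂ p * planeAffine y₀ y₁ y₂ p
            * g' (planeAffine x₀ x₁ x₂ p * planeAffine y₀ y₁ y₂ p)
          ∂((gaussianReal 0 1).prod (gaussianReal 0 1))) := by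
  have hg : Continuous g := continuous_iff_continuousAt.2 fun x => (hd x).continuousAt
  have hG : Continuous fun p => g (planeAffine x₀ x₁ x₂ p * planeAffine y₀ y₁ y₂ p) :=
    hg.comp ((continuous_planeAffine x₀ x₁ x₂).mul (continuous_planeAffine y₀ y₁ y₂))
  have hB : ∃ C, ∀ p, |g (planeAffine x₀ x₁ x₂ p * planeAffine y₀ y₁ y₂ p)| ≤ C :=
    hb.imp fun C hC p => hC _
  have k1 := integral_fst_mul_affine_mul_comp hd hg' hb hb' p₀ p₁ p₂ x₀ x₁ x₂ y₀ y₁ y₂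
  have k2 := integral_snd_mul_affine_mul_comp hd hg' hb hb' p₀ p₁ p₂ x₀ x₁ x₂ y₀ y₁ y₂
  have i0 := (integrable_planeAffine_mul hG hB p₀ p₁ p₂).const_mul l₀
  have i1 : Integrable (fun p : ℝ × ℝ => l₁ * (p.1 * (planeAffine p₀ p₁ p₂ p
      * g (planeAffine x₀ x₁ x₂ p * planeAffine y₀ y₁ y₂ p))))
      ((gaussianReal 0 1).prod (gaussianReal 0 1)) := by
    refine (integrable_planeAffine_mul_mul hG hB 0 l₁ 0 p₀ p₁ p₂).congr
      (ae_of_all _ fun p => ?_)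
    simp only [show planeAffine 0 l₁ 0 p = l₁ * p.1 by simp [planeAffine], mul_assoc]
  have i2 : Integrable (fun p : ℝ × ℝ => l₂ * (p.2 * (planeAffine p₀ p₁ p₂ p
      * g (planeAffine x₀ x₁ x₂ p * planeAffine y₀ y₁ y₂ p))))
      ((gaussianReal 0 1).prod (gaussianReal 0 1)) := by
    refine (integrable_planeAffine_mul_mul hG hB 0 0 l₂ p₀ p₁ p₂).congr
      (ae_of_all _ fun p => ?_)
    simp only [show planeAffine 0 0 l₂ p = l₂ * p.2 by simp [planeAffine], mul_assoc]
  have split : ∫ p, planeAffine l₀ l₁ l₂ p * planeAffine p₀ p₁ p₂ p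
          * g (planeAffine x₀ x₁ x₂ p * planeAffine y₀ y₁ y₂ p)
        ∂((gaussianReal 0 1).prod (gaussianReal 0 1))
      = l₀ * (∫ p, planeAffine p₀ p₁ p₂ p
            * g (planeAffine x₀ x₁ x₂ p * planeAffine y₀ y₁ y₂ p)
          ∂((gaussianReal 0 1).prod (gaussianReal 0 1)))
        + l₁ * (∫ p, p.1 * (planeAffine p₀ p₁ p₂ p
            * g (planeAffine x₀ x₁ x₂ p * planeAffine y₀ y₁ y₂ p))
          ∂((gaussianReal 0 1).prod (gaussianReal 0 1)))
        + l₂ * (∫ p, p.2 * (planeAffine p₀ p₁ p₂ p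
            * g (planeAffine x₀ x₁ x₂ p * planeAffine y₀ y₁ y₂ p))
          ∂((gaussianReal 0 1).prod (gaussianReal 0 1))) := by
    rw [← integral_const_mul, ← integral_const_mul, ← integral_const_mul]
    refine Eq.trans ?_ (Eq.trans (integral_add (i0.add i1) i2)
      (congrArg₂ _ (integral_add i0 i1) rfl))
    congr 1
    ext p
    simp only [Pi.add_apply]
    rw [show planeAffine l₀ l₁ l₂ p = l₀ + l₁ * p.1 + l₂ * p.2 from rfl]
    ring
  rw [split, k1, k2]
  ring

end AffineProduct

/-- The Stein operator of a product of correlated normals with unit variances has mean zero on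
chains `G 0, …, G 4` of bounded successive derivatives. -/
lemma stein_identity_of_bounded_derivatives (a b ρ c : ℝ) (hc : c ^ 2 = 1 - ρ ^ 2)
    (G : ℕ → ℝ → ℝ)
    (hd : ∀ k < 4, ∀ x, HasDerivAt (G k) (G (k + 1) x) x) (hcont : ∀ k ≤ 4, Continuous (G k))
    (hb : ∀ k ≤ 4, ∃ C, ∀ x, |G k x| ≤ C)
    (e ez : ℕ → ℝ)
    (he : ∀ k, e k = ∫ p, G k (planeAffine a 1 0 p * planeAffine b ρ c p)
      ∂((gaussianReal 0 1).prod (gaussianReal 0 1)))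
    (hez : ∀ k, ez k = ∫ p, planeAffine a 1 0 p * planeAffine b ρ c p
        * G k (planeAffine a 1 0 p * planeAffine b ρ c p)
      ∂((gaussianReal 0 1).prod (gaussianReal 0 1))) :
    (1 - ρ ^ 2) ^ 2 * ez 4 + (1 - ρ ^ 2) * ((1 - ρ ^ 2) * e 3 + 4 * ρ * ez 3)
      + ((ρ * (a ^ 2 + b ^ 2) - (1 + ρ ^ 2) * a * b + 3 * ρ * (1 - ρ ^ 2)) * e 2
        + (6 * ρ ^ 2 - 2) * ez 2)
      + ((2 * ρ * a * b - a ^ 2 - b ^ 2 + 3 * ρ ^ 2 - 1) * e 1 - 4 * ρ * ez 1)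
      + (ez 0 - a * b * e 0 - ρ * e 0) = 0 := by
  obtain ⟨eX, hX⟩ : ∃ eX : ℕ → ℝ, ∀ k, eX k = ∫ p, planeAffine a 1 0 p
      * G k (planeAffine a 1 0 p * planeAffine b ρ c p)
      ∂((gaussianReal 0 1).prod (gaussianReal 0 1)) := ⟨_, fun _ => rfl⟩
  obtain ⟨eY, hY⟩ : ∃ eY : ℕ → ℝ, ∀ k, eY k = ∫ p, planeAffine b ρ c p
      * G k (planeAffine a 1 0 p * planeAffine b ρ c p)
      ∂((gaussianReal 0 1).prod (gaussianReal 0 1)) := ⟨_, fun _ => rfl⟩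
  obtain ⟨eXX, hXX⟩ : ∃ eXX : ℕ → ℝ, ∀ k, eXX k = ∫ p, planeAffine a 1 0 p
      * planeAffine a 1 0 p * G k (planeAffine a 1 0 p * planeAffine b ρ c p)
      ∂((gaussianReal 0 1).prod (gaussianReal 0 1)) := ⟨_, fun _ => rfl⟩
  have hone : ∀ p, planeAffine 1 0 0 p = 1 := by
    intro p
    simp [planeAffine]
  have hcomm : ∀ k, ez k = ∫ p, planeAffine b ρ c p * planeAffine a 1 0 p
        * G k (planeAffine a 1 0 p * planeAffine b ρ c p)
      ∂((gaussianReal 0 1).prod (gaussianReal 0 1)) := by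
    intro k
    rw [hez]
    congr 1
    ext p
    ring
  have S : ∀ k < 4, ∀ l₀ l₁ l₂ p₀ p₁ p₂, _ := fun k hk l₀ l₁ l₂ p₀ p₁ p₂ =>
    integral_affine_mul_affine_mul_comp (hd k hk) (hcont (k + 1) (by lia)) (hb k (by lia))
      (hb (k + 1) (by lia)) l₀ l₁ l₂ p₀ p₁ p₂ a 1 0 b ρ c
  have S1 : ∀ k < 4, eX k = a * e k + ρ * eX (k + 1) + eY (k + 1) := by
    intro k hk
    have h := S k hk a 1 0 1 0 0
    simp only [hone, mul_one, one_mul, ← he, ← hX, ← hY] at h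
    rw [h]
    ring
  have S2 : ∀ k < 4, eY k = b * e k + eX (k + 1) + ρ * eY (k + 1) := by
    intro k hk
    have h := S k hk b ρ c 1 0 0
    simp only [hone, mul_one, one_mul, ← he, ← hX, ← hY] at h
    rw [h]
    linear_combination eX (k + 1) * hc
  have S3 : ∀ k < 4, eXX k = a * eX k + e k + ez (k + 1) + ρ * eXX (k + 1) := by
    intro k hk
    have h := S k hk a 1 0 a 1 0
    simp only [← hez, ← he, ← hX, ← hXX] at h
    rw [h]
    ring
  have S4 : ∀ k < 4, ez k = b * eX k + ρ * e k + ρ * ez (k + 1) + eXX (k + 1) := by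
    intro k hk
    have h := S k hk b ρ c a 1 0
    simp only [← hcomm, ← he, ← hX, ← hXX, ← hez] at h
    rw [h]
    linear_combination eXX (k + 1) * hc
  have s10 := S1 0 (by norm_num)
  have s11 := S1 1 (by norm_num)
  have s12 := S1 2 (by norm_num)
  have s21 := S2 1 (by norm_num)
  have s22 := S2 2 (by norm_num)
  have s31 := S3 1 (by norm_num)
  have s32 := S3 2 (by norm_num)
  have s33 := S3 3 (by norm_num)
  have s40 := S4 0 (by norm_num)
  have s41 := S4 1 (by norm_num)
  have s42 := S4 2 (by norm_num)
  have s43 := S4 3 (by norm_num)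
  norm_num at s10 s11 s12 s21 s22 s31 s32 s33 s40 s41 s42 s43
  linear_combination s40 - 3 * ρ * s41 + (2 * ρ ^ 2 - (1 - ρ ^ 2)) * s42
    + (1 - ρ ^ 2) * ρ * s43 + s31 - 2 * ρ * s32 - (1 - ρ ^ 2) * s33
    + b * s10 + (a - 2 * b * ρ) * s11 - ρ * (a - b * ρ) * s12 + b * s21 + (a - b * ρ) * s22

lemma hasCompactSupport_iteratedDeriv {f : ℝ → ℝ} (hf : HasCompactSupport f) (n : ℕ) :
    HasCompactSupport (iteratedDeriv n f) := by
  induction n with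
  | zero => simpa using hf
  | succ n ih =>
    rw [iteratedDeriv_succ]
    exact ih.deriv

open Filter Topology in
/-- Smooth cutoffs with uniformly bounded derivatives, eventually equal to one near any point. -/
lemma exists_cutoff_seq (N : ℕ) : ∃ χ : ℕ → ℝ → ℝ, (∀ n, ContDiff ℝ N (χ n)) ∧
    (∀ n, HasCompactSupport (χ n)) ∧
    (∃ C, ∀ n, ∀ i ≤ N, ∀ x, |iteratedDeriv i (χ n) x| ≤ C) ∧
    ∀ x, ∀ᶠ n in atTop, χ n =ᶠ[𝓝 x] fun _ => 1 := by
  let φ : ContDiffBump (0 : ℝ) := ⟨1, 2, one_pos, one_lt_two⟩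
  have hφ : ContDiff ℝ N φ := φ.contDiff
  have hε : ∀ n : ℕ, (0 : ℝ) < 1 / ((n : ℝ) + 1) := fun n => Nat.one_div_pos_of_nat
  have hε1 : ∀ n : ℕ, 1 / ((n : ℝ) + 1) ≤ 1 := by
    intro n
    rw [div_le_one (by positivity)]
    linarith [(Nat.cast_nonneg n : (0 : ℝ) ≤ n)]
  have hbound : ∀ i ≤ N, ∃ C, ∀ x, |iteratedDeriv i φ x| ≤ C := by
    intro i hi
    exact (hasCompactSupport_iteratedDeriv φ.hasCompactSupport i).exists_bound_of_continuous
      (hφ.continuous_iteratedDeriv i (by exact_mod_cast hi))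
  choose! C hC using hbound
  have hC0 : ∀ i ≤ N, 0 ≤ C i := fun i hi => (abs_nonneg _).trans (hC i hi 0)
  refine ⟨fun n x => φ (1 / ((n : ℝ) + 1) * x), fun n => hφ.comp (by fun_prop), fun n => ?_,
    ⟨∑ i ∈ Finset.range (N + 1), C i, fun n i hi x => ?_⟩, fun x => ?_⟩
  · exact φ.hasCompactSupport.comp_homeomorph (Homeomorph.mulLeft₀ _ (hε n).ne')
  · rw [iteratedDeriv_comp_const_mul (hφ.of_le (by exact_mod_cast hi)), abs_mul, abs_pow,
      abs_of_pos (hε n)]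
    calc (1 / ((n : ℝ) + 1)) ^ i * |iteratedDeriv i φ (1 / ((n : ℝ) + 1) * x)|
        ≤ 1 * C i := mul_le_mul (pow_le_one₀ (hε n).le (hε1 n)) (hC i hi _) (abs_nonneg _)
          zero_le_one
      _ = C i := one_mul _
      _ ≤ _ := Finset.single_le_sum (f := C)
          (fun j hj => hC0 j (Nat.lt_succ_iff.1 (Finset.mem_range.1 hj)))
          (Finset.mem_range.2 (Nat.lt_succ_iff.2 hi))
  · have ht : Tendsto (fun n : ℕ => 1 / ((n : ℝ) + 1) * x) atTop (𝓝 (0 * x)) :=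
      tendsto_one_div_add_atTop_nhds_zero_nat.mul_const x
    rw [zero_mul] at ht
    filter_upwards [ht.eventually (Metric.ball_mem_nhds (0 : ℝ) one_pos)] with n hn
    have hc : ContinuousAt (fun y : ℝ => 1 / ((n : ℝ) + 1) * y) x := by fun_prop
    exact hc.eventually (φ.eventuallyEq_one_of_mem_ball hn)

open Filter Topology in
/-- Dominated convergence for derivatives of `f` multiplied by cutoffs, with a weight `w`. -/
lemma tendsto_integral_iteratedDeriv_mul_cutoff {ν : Measure ℝ} {N m : ℕ} (hm : m ≤ N)
    {f w : ℝ → ℝ} (hf : ContDiff ℝ N f) (hw : Continuous w) {χ : ℕ → ℝ → ℝ}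
    (hχ : ∀ n, ContDiff ℝ N (χ n))
    (hb : ∃ C, ∀ n, ∀ i ≤ N, ∀ x, |iteratedDeriv i (χ n) x| ≤ C)
    (h1 : ∀ x, ∀ᶠ n in atTop, χ n =ᶠ[𝓝 x] fun _ => 1)
    (hint : ∀ i ≤ m, Integrable (fun x => w x * iteratedDeriv i f x) ν) :
    (∀ n, Integrable (fun x => w x * iteratedDeriv m (fun y => f y * χ n y) x) ν) ∧
    Tendsto (fun n => ∫ x, w x * iteratedDeriv m (fun y => f y * χ n y) x ∂ν) atTop
      (𝓝 (∫ x, w x * iteratedDeriv m f x ∂ν)) := by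
  obtain ⟨C, hC⟩ := hb
  have hmeas : ∀ n, AEStronglyMeasurable
      (fun x => w x * iteratedDeriv m (fun y => f y * χ n y) x) ν := fun n =>
    (hw.mul ((hf.mul (hχ n)).continuous_iteratedDeriv m
      (by exact_mod_cast hm))).aestronglyMeasurable
  have hdom : Integrable (fun x => ∑ i ∈ Finset.range (m + 1),
      (m.choose i : ℝ) * C * |w x * iteratedDeriv i f x|) ν :=
    integrable_finsetSum _ fun i hi =>
      ((hint i (Nat.lt_succ_iff.1 (Finset.mem_range.1 hi))).abs).const_mul _
  have hle : ∀ n, ∀ᵐ x ∂ν, ‖w x * iteratedDeriv m (fun y => f y * χ n y) x‖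
      ≤ ∑ i ∈ Finset.range (m + 1), (m.choose i : ℝ) * C * |w x * iteratedDeriv i f x| := by
    refine fun n => ae_of_all _ fun x => ?_
    have hmN : ((m : ℕ) : WithTop ℕ∞) ≤ N := by exact_mod_cast hm
    rw [iteratedDeriv_fun_mul (hf.of_le hmN).contDiffAt ((hχ n).of_le hmN).contDiffAt,
      Finset.mul_sum]
    refine (norm_sum_le _ _).trans (Finset.sum_le_sum fun i _ => ?_)
    rw [Real.norm_eq_abs, abs_mul, abs_mul, abs_mul, abs_mul, Nat.abs_cast]
    have := hC n (m - i) ((Nat.sub_le _ _).trans hm) x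
    calc |w x| * ((m.choose i : ℝ) * |iteratedDeriv i f x| * |iteratedDeriv (m - i) (χ n) x|)
        ≤ |w x| * ((m.choose i : ℝ) * |iteratedDeriv i f x| * C) := by gcongr
      _ = _ := by ring
  refine ⟨fun n => hdom.mono' (hmeas n) (hle n),
    tendsto_integral_of_dominated_convergence _ hmeas hdom hle (ae_of_all _ fun x => ?_)⟩
  refine tendsto_const_nhds.congr' ?_
  filter_upwards [h1 x] with n hn
  have : (fun y => f y * χ n y) =ᶠ[𝓝 x] f := by
    filter_upwards [hn] with y hy
    rw [hy, mul_one]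
  rw [this.iteratedDeriv_eq]

lemma continuous_PN_map (μX μY σX σY ρ : ℝ) : Continuous (fun p : ℝ × ℝ =>
    (μX + σX * p.1) * (μY + σY * (ρ * p.1 + Real.sqrt (1 - ρ ^ 2) * p.2))) := by
  fun_prop

lemma integral_PN (μX μY σX σY ρ : ℝ) {φ : ℝ → ℝ} (hφ : Continuous φ) :
    ∫ x, φ x ∂(PN μX μY σX σY ρ) = ∫ p, φ ((μX + σX * p.1)
      * (μY + σY * (ρ * p.1 + Real.sqrt (1 - ρ ^ 2) * p.2)))
      ∂((gaussianReal 0 1).prod (gaussianReal 0 1)) :=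
  integral_map (continuous_PN_map μX μY σX σY ρ).aemeasurable hφ.aestronglyMeasurable

/-- The integral of the Stein operator in terms of the integrals of its constituents. -/
lemma integral_A1_one {ν : Measure ℝ} (μX μY σX σY ρ : ℝ) {f : ℝ → ℝ}
    (hint : ∀ m ≤ 3, Integrable (iteratedDeriv m f) ν)
    (hintx : ∀ m ≤ 4, Integrable (fun x => x * iteratedDeriv m f x) ν)
    (E Ex : ℕ → ℝ) (hE : ∀ m, E m = ∫ x, iteratedDeriv m f x ∂ν)
    (hEx : ∀ m, Ex m = ∫ x, x * iteratedDeriv m f x ∂ν) :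
    ∫ x, A1 1 μX μY σX σY ρ f x ∂ν
      = (σX * σY) ^ 4 * (1 - ρ ^ 2) ^ 2 * Ex 4
        + (σX * σY) ^ 3 * (1 - ρ ^ 2) * (σX * σY * (1 - ρ ^ 2) * E 3 + 4 * ρ * Ex 3)
        + (σX * σY) ^ 2 * (σX * σY * (ρ * ((μX / σX) ^ 2 + (μY / σY) ^ 2)
            - (1 + ρ ^ 2) * (μX / σX) * (μY / σY) + 3 * ρ * (1 - ρ ^ 2)) * E 2
          + (6 * ρ ^ 2 - 2) * Ex 2)
        + (σX * σY) * (σX * σY * (2 * ρ * (μX / σX) * (μY / σY) - (μX / σX) ^ 2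
            - (μY / σY) ^ 2 + 3 * ρ ^ 2 - 1) * E 1 - 4 * ρ * Ex 1)
        + (Ex 0 - μX * μY * E 0 - σX * σY * ρ * E 0) := by
  set s := σX * σY with hs
  let c : Fin 5 → ℝ := ![1, -(4 * ρ * s), s ^ 2 * (6 * ρ ^ 2 - 2),
    s ^ 3 * (1 - ρ ^ 2) * (4 * ρ), s ^ 4 * (1 - ρ ^ 2) ^ 2]
  let d : Fin 4 → ℝ := ![-(μX * μY) - s * ρ,
    s * (s * (2 * ρ * (μX / σX) * (μY / σY) - (μX / σX) ^ 2 - (μY / σY) ^ 2 + 3 * ρ ^ 2 - 1)),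
    s ^ 2 * (s * (ρ * ((μX / σX) ^ 2 + (μY / σY) ^ 2)
            - (1 + ρ ^ 2) * (μX / σX) * (μY / σY) + 3 * ρ * (1 - ρ ^ 2))),
    s ^ 3 * (1 - ρ ^ 2) * (s * (1 - ρ ^ 2))]
  have hA : ∀ x, A1 1 μX μY σX σY ρ f x = ∑ i, c i * (x * iteratedDeriv i f x)
      + ∑ i, d i * iteratedDeriv i f x := by
    intro x
    simp [A1, c, d, Fin.sum_univ_succ, ← hs]
    ring
  have hc : ∀ i : Fin 5, Integrable (fun x => c i * (x * iteratedDeriv i f x)) ν :=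
    fun i => (hintx i (by lia)).const_mul _
  have hd : ∀ i : Fin 4, Integrable (fun x => d i * iteratedDeriv i f x) ν :=
    fun i => (hint i (by lia)).const_mul _
  simp_rw [hA]
  rw [integral_add (integrable_finsetSum _ fun i _ => hc i)
    (integrable_finsetSum _ fun i _ => hd i), integral_finsetSum _ fun i _ => hc i,
    integral_finsetSum _ fun i _ => hd i]
  simp_rw [integral_const_mul, ← hE, ← hEx]
  simp [c, d, Fin.sum_univ_succ]
  ring

/-- The Stein identity for compactly supported functions. -/
lemma integral_A1_PN_eq_zero_of_hasCompactSupport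
    (μX μY σX σY ρ : ℝ) (hσX : σX ≠ 0) (hσY : σY ≠ 0) (hρ : ρ ^ 2 ≤ 1)
    (f : ℝ → ℝ) (hf : ContDiff ℝ 4 f) (hsupp : HasCompactSupport f)
    (hint : ∀ m ≤ 3, Integrable (iteratedDeriv m f) (PN μX μY σX σY ρ))
    (hintx : ∀ m ≤ 4, Integrable (fun x => x * iteratedDeriv m f x) (PN μX μY σX σY ρ)) :
    ∫ x, A1 1 μX μY σX σY ρ f x ∂(PN μX μY σX σY ρ) = 0 := by
  have hcont : ∀ k ≤ 4, Continuous (iteratedDeriv k f) :=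
    fun k hk => hf.continuous_iteratedDeriv k (by exact_mod_cast hk)
  have hderiv : ∀ k < 4, ∀ x, HasDerivAt (iteratedDeriv k f) (iteratedDeriv (k + 1) f x) x := by
    intro k hk x
    rw [iteratedDeriv_succ]
    exact (hf.differentiable_iteratedDeriv k (by exact_mod_cast hk) x).hasDerivAt
  have hbdd : ∀ k ≤ 4, ∃ C, ∀ x, |iteratedDeriv k f x| ≤ C := fun k hk =>
    (hasCompactSupport_iteratedDeriv hsupp k).exists_bound_of_continuous (hcont k hk)
  set s := σX * σY with hs
  have hz : ∀ p, s * (planeAffine (μX / σX) 1 0 p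
      * planeAffine (μY / σY) ρ (Real.sqrt (1 - ρ ^ 2)) p)
      = (μX + σX * p.1) * (μY + σY * (ρ * p.1 + Real.sqrt (1 - ρ ^ 2) * p.2)) := by
    intro p
    simp only [planeAffine, hs]
    field_simp
    ring
  obtain ⟨E, hE⟩ : ∃ E : ℕ → ℝ, ∀ k, E k
      = ∫ x, iteratedDeriv k f x ∂(PN μX μY σX σY ρ) := ⟨_, fun _ => rfl⟩
  obtain ⟨Ex, hEx⟩ : ∃ Ex : ℕ → ℝ, ∀ k, Ex k
      = ∫ x, x * iteratedDeriv k f x ∂(PN μX μY σX σY ρ) := ⟨_, fun _ => rfl⟩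
  rw [integral_A1_one μX μY σX σY ρ hint hintx E Ex hE hEx]
  obtain ⟨e, he⟩ : ∃ e : ℕ → ℝ, ∀ k, e k = ∫ p, s ^ k * iteratedDeriv k f
      (s * (planeAffine (μX / σX) 1 0 p * planeAffine (μY / σY) ρ (Real.sqrt (1 - ρ ^ 2)) p))
      ∂((gaussianReal 0 1).prod (gaussianReal 0 1)) := ⟨_, fun _ => rfl⟩
  obtain ⟨ez, hez⟩ : ∃ ez : ℕ → ℝ, ∀ k, ez k = ∫ p, planeAffine (μX / σX) 1 0 p
      * planeAffine (μY / σY) ρ (Real.sqrt (1 - ρ ^ 2)) p * (s ^ k * iteratedDeriv k f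
      (s * (planeAffine (μX / σX) 1 0 p * planeAffine (μY / σY) ρ (Real.sqrt (1 - ρ ^ 2)) p)))
      ∂((gaussianReal 0 1).prod (gaussianReal 0 1)) := ⟨_, fun _ => rfl⟩
  have key := stein_identity_of_bounded_derivatives (μX / σX) (μY / σY) ρ (Real.sqrt (1 - ρ ^ 2))
    (Real.sq_sqrt (by linarith))
    (fun k z => s ^ k * iteratedDeriv k f (s * z))
    (by
      intro k hk x
      have h1 : HasDerivAt (fun z => s * z) s x := by simpa using (hasDerivAt_id x).const_mul s
      refine (((hderiv k hk (s * x)).comp x h1).const_mul (s ^ k)).congr_deriv ?_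
      ring)
    (fun k hk => continuous_const.mul ((hcont k hk).comp (continuous_const.mul continuous_id)))
    (by
      intro k hk
      obtain ⟨C, hC⟩ := hbdd k hk
      refine ⟨|s ^ k| * C, fun x => ?_⟩
      rw [abs_mul]
      exact mul_le_mul_of_nonneg_left (hC _) (abs_nonneg _))
    e ez he hez
  have e1 : ∀ k ≤ 4, e k = s ^ k * E k := by
    intro k hk
    rw [he, hE, integral_PN _ _ _ _ _ (hcont k hk), integral_const_mul]
    simp only [hz]
  have e2 : ∀ k ≤ 4, s * ez k = s ^ k * Ex k := by
    intro k hk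
    rw [hez, hEx, integral_PN (φ := fun x => x * iteratedDeriv k f x) _ _ _ _ _
      (continuous_id'.mul (hcont k hk)),
      ← integral_const_mul, ← integral_const_mul]
    simp only [← hz]
    congr 1
    ext p
    ring
  have hμ : μX * μY = s * (μX / σX) * (μY / σY) := by
    rw [hs]
    field_simp
  have f0 := e1 0 (by norm_num)
  have f1 := e1 1 (by norm_num)
  have f2 := e1 2 (by norm_num)
  have f3 := e1 3 (by norm_num)
  have g0 := e2 0 (by norm_num)
  have g1 := e2 1 (by norm_num)
  have g2 := e2 2 (by norm_num)
  have g3 := e2 3 (by norm_num)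
  have g4 := e2 4 (by norm_num)
  rw [f0, f1, f2, f3] at key
  rw [hμ]
  generalize μX / σX = a at *
  generalize μY / σY = b at *
  linear_combination s * key - (1 - ρ ^ 2) ^ 2 * g4 - (1 - ρ ^ 2) * (4 * ρ) * g3
    - (6 * ρ ^ 2 - 2) * g2 + 4 * ρ * g1 - g0

/-- Necessity part of the Stein characterisation for `Z ∼ PN(μX, μY; σX², σY²; ρ)`:
for every `C⁴` function `f` with `E|f⁽ᵐ⁾(Z)| < ∞` for `m = 0,1,2,3` and
`E|Z f⁽ᵐ⁾(Z)| < ∞` for `m = 0,1,2,3,4`, one has `E[A₁ f (Z)] = 0` (with `n = 1`). -/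
theorem stein_necessity_PN
    (μX μY σX σY ρ : ℝ) (hσX : 0 < σX) (hσY : 0 < σY)
    (hρ₁ : -1 < ρ) (hρ₂ : ρ < 1)
    (f : ℝ → ℝ) (hf : ContDiff ℝ 4 f)
    (hint : ∀ m ≤ 3, Integrable (iteratedDeriv m f) (PN μX μY σX σY ρ))
    (hintx : ∀ m ≤ 4, Integrable (fun x => x * iteratedDeriv m f x) (PN μX μY σX σY ρ)) :
    ∫ x, A1 1 μX μY σX σY ρ f x ∂(PN μX μY σX σY ρ) = 0 := by
  obtain ⟨χ, hχ, hχs, hχb, hχ1⟩ := exists_cutoff_seq 4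
  have hf' : ContDiff ℝ ((4 : ℕ) : WithTop ℕ∞) f := hf
  have t1 := fun m (hm : m ≤ 3) => tendsto_integral_iteratedDeriv_mul_cutoff
    (ν := PN μX μY σX σY ρ) (w := fun _ => 1) (m := m) (by lia) hf' continuous_const
    hχ hχb hχ1 (fun i hi => by simpa using hint i (hi.trans hm))
  have tx := fun m (hm : m ≤ 4) => tendsto_integral_iteratedDeriv_mul_cutoff
    (ν := PN μX μY σX σY ρ) (w := fun x => x) hm hf' continuous_id
    hχ hχb hχ1 (fun i hi => hintx i (hi.trans hm))
  simp only [one_mul] at t1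
  have hzero := fun n => integral_A1_PN_eq_zero_of_hasCompactSupport μX μY σX σY ρ hσX.ne' hσY.ne'
    (by nlinarith) (fun y => f y * χ n y) (hf'.mul (hχ n)) ((hχs n).mul_left)
    (fun m hm => (t1 m hm).1 n) (fun m hm => (tx m hm).1 n)
  have hexp := fun n => integral_A1_one μX μY σX σY ρ
    (fun m hm => (t1 m hm).1 n) (fun m hm => (tx m hm).1 n) _ _ (fun _ => rfl) (fun _ => rfl)
  rw [integral_A1_one μX μY σX σY ρ hint hintx _ _ (fun _ => rfl) (fun _ => rfl)]
  have a0 := (t1 0 (by norm_num)).2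
  have a1 := (t1 1 (by norm_num)).2
  have a2 := (t1 2 (by norm_num)).2
  have a3 := (t1 3 (by norm_num)).2
  have b0 := (tx 0 (by norm_num)).2
  have b1 := (tx 1 (by norm_num)).2
  have b2 := (tx 2 (by norm_num)).2
  have b3 := (tx 3 (by norm_num)).2
  have b4 := (tx 4 (by norm_num)).2
  refine tendsto_nhds_unique (((((b4.const_mul _).add
    (((a3.const_mul _).add (b3.const_mul _)).const_mul _)).add
    (((a2.const_mul _).add (b2.const_mul _)).const_mul _)).add
    (((a1.const_mul _).sub (b1.const_mul _)).const_mul _)).add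
    ((b0.sub (a0.const_mul _)).sub (a0.const_mul _))) (tendsto_const_nhds.congr fun n => ?_)
  rw [← hexp n, hzero n]
end

section
/- Let n ≥ 1 and let W be a real-valued random variable with E|W| < ∞. Suppose that E[A₁f(W)] = 0 for every function f : ℝ → ℝ of class C⁴ such that E|f^{(m)}(Z̄_n)| < ∞ for m = 0,1,2,3 and E|Z̄_n·f^{(m)}(Z̄_n)| < ∞ for m = 0,1,2,3,4 (in particular for all f whose derivatives up to order four are bounded, and for which the left-hand side is defined). Then W has the same distribution as Z̄_n, the mean of n independent PN(μ_X,μ_Y;σ_X²,σ_Y²;ρ) random variables. -/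
open MeasureTheory ProbabilityTheory

namespace ProductNormal

open Complex

/-- The general real trigonometric function of frequency `t`. -/
noncomputable def trig (t α β : ℝ) (x : ℝ) : ℝ := α * Real.cos (t * x) + β * Real.sin (t * x)

lemma contDiff_trig (t α β : ℝ) (k : WithTop ℕ∞) : ContDiff ℝ k (trig t α β) := by
  unfold trig
  fun_prop

lemma deriv_trig (t α β : ℝ) : deriv (trig t α β) = trig t (t * β) (-(t * α)) := by
  ext x
  have h : HasDerivAt (fun y : ℝ => t * y) t x := by simpa using (hasDerivAt_id x).const_mul t
  have h2 := (h.cos.const_mul α).add (h.sin.const_mul β)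
  refine (h2.congr_deriv ?_).deriv
  unfold trig
  ring

lemma iteratedDeriv_trig_succ (m : ℕ) (t α β : ℝ) :
    iteratedDeriv (m + 1) (trig t α β) = iteratedDeriv m (trig t (t * β) (-(t * α))) := by
  rw [iteratedDeriv_succ', deriv_trig]

lemma exists_iteratedDeriv_trig (m : ℕ) (t α β : ℝ) :
    ∃ α' β', iteratedDeriv m (trig t α β) = trig t α' β' := by
  induction m generalizing α β with
  | zero => exact ⟨α, β, iteratedDeriv_zero⟩
  | succ m ih => rw [iteratedDeriv_trig_succ]; exact ih _ _

lemma abs_trig_le (t α β x : ℝ) : |trig t α β x| ≤ |α| + |β| := by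
  unfold trig
  refine (abs_add_le _ _).trans ?_
  rw [abs_mul, abs_mul]
  gcongr
  · exact mul_le_of_le_one_right (abs_nonneg _) (Real.abs_cos_le_one _)
  · exact mul_le_of_le_one_right (abs_nonneg _) (Real.abs_sin_le_one _)

lemma integrable_trig_comp {Ω : Type*} [MeasurableSpace Ω] {P : Measure Ω} [IsFiniteMeasure P]
    {W : Ω → ℝ} (hW : Measurable W) (t α β : ℝ) : Integrable (fun ω => trig t α β (W ω)) P :=
  Integrable.of_bound
    (((contDiff_trig t α β 0).continuous.measurable.comp hW).aestronglyMeasurable) (|α| + |β|)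
    (ae_of_all _ fun _ => abs_trig_le _ _ _ _)

lemma integrable_mul_trig_comp {Ω : Type*} [MeasurableSpace Ω] {P : Measure Ω}
    {W : Ω → ℝ} (hW : Measurable W) (hWint : Integrable W P) (t α β : ℝ) :
    Integrable (fun ω => W ω * trig t α β (W ω)) P :=
  hWint.mul_bdd (c := |α| + |β|)
    (((contDiff_trig t α β 0).continuous.measurable.comp hW).aestronglyMeasurable)
    (ae_of_all _ fun _ => abs_trig_le _ _ _ _)

lemma integrable_A1_trig {Ω : Type*} [MeasurableSpace Ω] {P : Measure Ω} [IsFiniteMeasure P]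
    {W : Ω → ℝ} (hW : Measurable W) (hWint : Integrable W P) (n : ℕ) (μX μY σX σY ρ t α β : ℝ) :
    Integrable (fun ω => A1 n μX μY σX σY ρ (trig t α β) (W ω)) P := by
  have key : ∀ (c d : ℝ) (m : ℕ),
      Integrable (fun ω => (c + d * W ω) * iteratedDeriv m (trig t α β) (W ω)) P := by
    intro c d m
    obtain ⟨α', β', h⟩ := exists_iteratedDeriv_trig m t α β
    rw [h]
    refine (((integrable_trig_comp hW t α' β').const_mul c).add
      ((integrable_mul_trig_comp hW hWint t α' β').const_mul d)).congr (ae_of_all _ fun ω => ?_)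
    simp only [Pi.add_apply]
    ring
  unfold A1
  refine ((((key 0 ((σX * σY / (n : ℝ)) ^ 4 * (1 - ρ ^ 2) ^ 2) 4).add
    (key ((σX * σY / (n : ℝ)) ^ 3 * (1 - ρ ^ 2) * ((n : ℝ) * (σX * σY / (n : ℝ)) * (1 - ρ ^ 2)))
      ((σX * σY / (n : ℝ)) ^ 3 * (1 - ρ ^ 2) * (4 * ρ)) 3)).add
    (key ((σX * σY / (n : ℝ)) ^ 2
        * ((n : ℝ) * (σX * σY / (n : ℝ)) * (ρ * ((μX / σX) ^ 2 + (μY / σY) ^ 2)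
              - (1 + ρ ^ 2) * (μX / σX) * (μY / σY) + 3 * ρ * (1 - ρ ^ 2))))
      ((σX * σY / (n : ℝ)) ^ 2 * (6 * ρ ^ 2 - 2)) 2)).add
    (key ((σX * σY / (n : ℝ))
        * ((n : ℝ) * (σX * σY / (n : ℝ)) * (2 * ρ * (μX / σX) * (μY / σY) - (μX / σX) ^ 2
              - (μY / σY) ^ 2 + 3 * ρ ^ 2 - 1))) ((σX * σY / (n : ℝ)) * (- 4 * ρ)) 1)).add
    (key (- μX * μY - (n : ℝ) * (σX * σY / (n : ℝ)) * ρ) 1 0) |>.congr (ae_of_all _ fun ω => ?_)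
  simp only [Pi.add_apply, iteratedDeriv_zero]
  ring

/-- With `c = σX σY` and `w = i c t`, the polynomial `1 - 2 ρ w - (1 - ρ²) w²`. -/
noncomputable def den (c ρ t : ℝ) : ℂ :=
  1 - 2 * ρ * (I * c * t) - (1 - ρ ^ 2) * (I * c * t) ^ 2

/-- The numerator of the exponent of the characteristic function of `PN`. -/
noncomputable def num (μX μY σX σY ρ t : ℝ) : ℂ :=
  I * t * (μX * μY)
    - t ^ 2 * (μX ^ 2 * σY ^ 2 + μY ^ 2 * σX ^ 2 - 2 * ρ * (μX * μY * σX * σY)) / 2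

/-- The numerator of the logarithmic derivative of the characteristic function of `PN`, whose
denominator is the square of `den`. -/
noncomputable def logDerivNum (μX μY σX σY ρ t : ℝ) : ℂ :=
  I * (μX * μY + σX * σY * ρ)
    - t * (μX ^ 2 * σY ^ 2 + μY ^ 2 * σX ^ 2 - 2 * ρ * (μX * μY * σX * σY)
        + (1 - 3 * ρ ^ 2) * (σX * σY) ^ 2)
    - I * t ^ 2 * (σX * σY) * ((1 + ρ ^ 2) * (μX * μY * σX * σY)
        - ρ * (μX ^ 2 * σY ^ 2 + μY ^ 2 * σX ^ 2) - 3 * ρ * (1 - ρ ^ 2) * (σX * σY) ^ 2)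
    - t ^ 3 * (1 - ρ ^ 2) ^ 2 * (σX * σY) ^ 4

/-- The closed form of the characteristic function of `PN`. -/
noncomputable def closedForm (μX μY σX σY ρ t : ℝ) : ℂ :=
  (den (σX * σY) ρ t)⁻¹ ^ (1 / 2 : ℂ) * cexp (num μX μY σX σY ρ t / den (σX * σY) ρ t)

lemma den_re (c ρ t : ℝ) : (den c ρ t).re = 1 + (1 - ρ ^ 2) * (c * t) ^ 2 := by
  have : den c ρ t = ((1 + (1 - ρ ^ 2) * (c * t) ^ 2 : ℝ) : ℂ) + ((- 2 * ρ * c * t : ℝ) : ℂ) * I := by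
    unfold den
    push_cast
    linear_combination (-(1 - ρ ^ 2) * (c * t) ^ 2 : ℂ) * I_sq
  rw [this, add_re, ofReal_re, re_ofReal_mul, I_re, mul_zero, add_zero]

lemma den_re_pos {ρ : ℝ} (hρ₁ : -1 < ρ) (hρ₂ : ρ < 1) (c t : ℝ) : 0 < (den c ρ t).re := by
  rw [den_re]
  have : 0 < 1 - ρ ^ 2 := by nlinarith
  positivity

lemma den_ne_zero {ρ : ℝ} (hρ₁ : -1 < ρ) (hρ₂ : ρ < 1) (c t : ℝ) : den c ρ t ≠ 0 := by
  intro h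
  have := den_re_pos hρ₁ hρ₂ c t
  simp [h] at this

lemma inv_den_mem_slitPlane {ρ : ℝ} (hρ₁ : -1 < ρ) (hρ₂ : ρ < 1) (c t : ℝ) :
    (den c ρ t)⁻¹ ∈ slitPlane := by
  left
  rw [inv_re]
  exact div_pos (den_re_pos hρ₁ hρ₂ c t) (normSq_pos.2 (den_ne_zero hρ₁ hρ₂ c t))

lemma hasDerivAt_ofReal (t : ℝ) : HasDerivAt (fun s : ℝ => (s : ℂ)) 1 t :=
  (hasDerivAt_id t).ofReal_comp

lemma hasDerivAt_den (c ρ t : ℝ) :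
    HasDerivAt (den c ρ) (- 2 * ρ * (I * c) - 2 * (1 - ρ ^ 2) * (I * c) ^ 2 * t) t := by
  have h := (hasDerivAt_ofReal t).const_mul (I * c)
  refine (((hasDerivAt_const t (1 : ℂ)).sub (h.const_mul (2 * ρ : ℂ))).sub
    ((h.pow 2).const_mul (1 - ρ ^ 2 : ℂ))).congr_deriv ?_
  push_cast
  ring

lemma hasDerivAt_num (μX μY σX σY ρ t : ℝ) :
    HasDerivAt (num μX μY σX σY ρ) (I * (μX * μY)
      - t * (μX ^ 2 * σY ^ 2 + μY ^ 2 * σX ^ 2 - 2 * ρ * (μX * μY * σX * σY))) t := by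
  have h := hasDerivAt_ofReal t
  refine (((h.const_mul I).mul_const (μX * μY : ℂ)).sub (((h.pow 2).mul_const
    (μX ^ 2 * σY ^ 2 + μY ^ 2 * σX ^ 2 - 2 * ρ * (μX * μY * σX * σY) : ℂ)).div_const 2)).congr_deriv ?_
  push_cast
  ring

lemma closedForm_ne_zero {ρ : ℝ} (hρ₁ : -1 < ρ) (hρ₂ : ρ < 1) (μX μY σX σY t : ℝ) :
    closedForm μX μY σX σY ρ t ≠ 0 := by
  refine mul_ne_zero ?_ (exp_ne_zero _)
  rw [Ne, cpow_eq_zero_iff]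
  exact fun h => inv_ne_zero (den_ne_zero hρ₁ hρ₂ _ t) h.1

lemma hasDerivAt_closedForm {ρ : ℝ} (hρ₁ : -1 < ρ) (hρ₂ : ρ < 1) (μX μY σX σY t : ℝ) :
    HasDerivAt (closedForm μX μY σX σY ρ) (closedForm μX μY σX σY ρ t *
      (logDerivNum μX μY σX σY ρ t / den (σX * σY) ρ t ^ 2)) t := by
  have hd := den_ne_zero hρ₁ hρ₂ (σX * σY) t
  have hD := hasDerivAt_den (σX * σY) ρ t
  have hN := hasDerivAt_num μX μY σX σY ρ t
  have h1 : HasDerivAt (fun s => (den (σX * σY) ρ s)⁻¹ ^ (1 / 2 : ℂ)) _ t :=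
    HasDerivAt.comp_of_eq t ((hasDerivAt_id _).cpow_const (c := (1 / 2 : ℂ))
      (inv_den_mem_slitPlane hρ₁ hρ₂ (σX * σY) t)) (hD.inv hd) rfl
  refine (h1.mul (hN.div hD hd).cexp).congr_deriv ?_
  simp only [id, Pi.div_apply]
  rw [cpow_sub _ _ (inv_ne_zero hd), cpow_one]
  unfold closedForm
  set E := cexp (num μX μY σX σY ρ t / den (σX * σY) ρ t)
  set R := (den (σX * σY) ρ t)⁻¹ ^ (1 / 2 : ℂ)
  field_simp
  unfold den num logDerivNum
  push_cast
  have hI := I_sq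
  clear_value E R
  clear h1 hN hD hd hρ₁ hρ₂
  grind

instance (μX μY σX σY ρ : ℝ) : IsProbabilityMeasure (PN μX μY σX σY ρ) := by
  unfold PN
  exact Measure.isProbabilityMeasure_map (by fun_prop)

lemma charFun_PN {ρ : ℝ} (hρ₁ : -1 < ρ) (hρ₂ : ρ < 1) (μX μY σX σY t : ℝ) :
    charFun (PN μX μY σX σY ρ) t = closedForm μX μY σX σY ρ t := by
  have hc : ((Real.sqrt (1 - ρ ^ 2) : ℝ) : ℂ) ^ 2 = 1 - ρ ^ 2 := by
    rw [← ofReal_pow, Real.sq_sqrt (by nlinarith)]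
    push_cast
    rfl
  have hd := den_ne_zero hρ₁ hρ₂ (σX * σY) t
  have hdr := den_re_pos hρ₁ hρ₂ (σX * σY) t
  set c := Real.sqrt (1 - ρ ^ 2)
  set C : ℂ := I * t * (μX * σY * ρ + μY * σX) - t ^ 2 * μX * σX * σY ^ 2 * (1 - ρ ^ 2) with hC
  set D : ℂ := I * t * (μX * μY) - t ^ 2 * μX ^ 2 * σY ^ 2 * (1 - ρ ^ 2) / 2 with hD
  have hint : Integrable (fun p : ℝ × ℝ => cexp (t * ((μX + σX * p.1) *
      (μY + σY * (ρ * p.1 + c * p.2)) : ℝ) * I)) ((gaussianReal 0 1).prod (gaussianReal 0 1)) := by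
    refine Integrable.of_bound (by fun_prop) 1 (ae_of_all _ fun p => ?_)
    rw [← ofReal_mul, norm_exp_ofReal_mul_I]
  have hinner : ∀ u : ℝ, ∫ v : ℝ, cexp (t * ((μX + σX * u) *
      (μY + σY * (ρ * u + c * v)) : ℝ) * I) ∂(gaussianReal 0 1)
      = cexp ((1 - den (σX * σY) ρ t) / 2 * u ^ 2 + C * u + D) := by
    intro u
    have h1 : ∀ v : ℝ, cexp (t * ((μX + σX * u) * (μY + σY * (ρ * u + c * v)) : ℝ) * I)
        = cexp (t * ((μX + σX * u) * (μY + σY * (ρ * u))) * I)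
          * cexp ((t * (μX + σX * u) * σY * c : ℝ) * v * I) := by
      intro v
      rw [← Complex.exp_add]
      congr 1
      push_cast
      ring
    simp_rw [h1]
    rw [integral_const_mul, ← charFun_apply_real, charFun_gaussianReal, ← Complex.exp_add]
    congr 1
    rw [hC, hD]
    unfold den
    push_cast
    linear_combination (-(t * (μX + σX * u) * σY) ^ 2 / 2 : ℂ) * hc
      - ((1 - ρ ^ 2) * (σX * σY * t) ^ 2 * u ^ 2 / 2 : ℂ) * I_sq
  have hNum : D * den (σX * σY) ρ t + C ^ 2 / 2 = num μX μY σX σY ρ t := by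
    rw [hC, hD]
    unfold den num
    push_cast
    have hI := I_sq
    clear * - hI
    grind
  unfold PN
  rw [charFun_apply_real, integral_map (by fun_prop) (by fun_prop), integral_prod _ hint]
  simp_rw [hinner]
  rw [integral_gaussianReal_eq_integral_smul one_ne_zero]
  have hpdf : ∀ u : ℝ, gaussianPDFReal 0 1 u •
      cexp ((1 - den (σX * σY) ρ t) / 2 * u ^ 2 + C * u + D)
      = ((Real.sqrt (2 * Real.pi))⁻¹ : ℝ) *
        cexp (-(den (σX * σY) ρ t / 2) * u ^ 2 + C * u + D) := by
    intro u
    rw [gaussianPDFReal_def, real_smul]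
    push_cast
    rw [mul_assoc, ← Complex.exp_add]
    simp only [mul_one, sub_zero]
    congr 2
    ring
  simp_rw [hpdf]
  rw [integral_const_mul, integral_cexp_quadratic (by simpa using hdr)]
  unfold closedForm
  have hpow : (Real.pi / - -(den (σX * σY) ρ t / 2) : ℂ) ^ (1 / 2 : ℂ)
      = (Real.sqrt (2 * Real.pi) : ℝ) * (den (σX * σY) ρ t)⁻¹ ^ (1 / 2 : ℂ) := by
    rw [show (Real.pi / - -(den (σX * σY) ρ t / 2) : ℂ)
      = ((2 * Real.pi : ℝ) : ℂ) * (den (σX * σY) ρ t)⁻¹ by push_cast; field_simp]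
    rw [cpow_def_of_ne_zero (mul_ne_zero (ofReal_ne_zero.2 (by positivity)) (inv_ne_zero hd)),
      log_ofReal_mul (by positivity) (inv_ne_zero hd), add_mul, Complex.exp_add,
      cpow_def_of_ne_zero (inv_ne_zero hd), Real.sqrt_eq_rpow, Real.rpow_def_of_pos (by positivity)]
    push_cast
    rfl
  rw [hpow, ← mul_assoc, ← mul_assoc, ← ofReal_mul, inv_mul_cancel₀ (by positivity), ofReal_one,
    one_mul]
  congr 2
  rw [← hNum]
  field_simp
  ring

lemma charFun_PNbar {ρ : ℝ} (hρ₁ : -1 < ρ) (hρ₂ : ρ < 1) (n : ℕ) (μX μY σX σY t : ℝ) :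
    charFun (PNbar n μX μY σX σY ρ) t = closedForm μX μY σX σY ρ ((n : ℝ)⁻¹ * t) ^ n := by
  unfold PNbar
  simp_rw [div_eq_inv_mul]
  rw [charFun_map_mul_comp (by fun_prop), charFun_map_sum_pi_eq_prod, Finset.prod_apply,
    Finset.prod_const, charFun_PN hρ₁ hρ₂, Finset.card_univ, Fintype.card_fin]

instance (n : ℕ) (μX μY σX σY ρ : ℝ) : IsProbabilityMeasure (PNbar n μX μY σX σY ρ) := by
  unfold PNbar
  exact Measure.isProbabilityMeasure_map (by fun_prop)

lemma integrable_id_PN (μX μY σX σY ρ : ℝ) : Integrable id (PN μX μY σX σY ρ) := by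
  unfold PN
  rw [integrable_map_measure (by fun_prop) (by fun_prop)]
  have h2 : Integrable (fun x : ℝ => x ^ 2) (gaussianReal 0 1) :=
    (memLp_id_gaussianReal 2).integrable_sq
  have h1 : Integrable (fun x : ℝ => x) (gaussianReal 0 1) :=
    memLp_one_iff_integrable.1 (memLp_id_gaussianReal 1)
  have e1 := h1.comp_fst (gaussianReal 0 1)
  have e2 := h1.comp_snd (gaussianReal 0 1)
  have e3 := h2.comp_fst (gaussianReal 0 1)
  have e4 := h1.mul_prod h1
  refine (((((integrable_const (μX * μY)).add (e1.const_mul (μX * σY * ρ + σX * μY))).add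
    (e3.const_mul (σX * σY * ρ))).add (e2.const_mul (μX * σY * √(1 - ρ ^ 2)))).add
    (e4.const_mul (σX * σY * √(1 - ρ ^ 2)))).congr (ae_of_all _ fun p => ?_)
  simp only [Pi.add_apply, Function.comp_apply, id]
  ring

lemma integrable_id_PNbar (n : ℕ) (μX μY σX σY ρ : ℝ) :
    Integrable id (PNbar n μX μY σX σY ρ) := by
  unfold PNbar
  rw [integrable_map_measure (by fun_prop) (by fun_prop)]
  exact (integrable_finsetSum _ fun i _ =>
    integrable_comp_eval (i := i) (f := id) (integrable_id_PN μX μY σX σY ρ)).div_const _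

lemma A1_trig {n : ℕ} (hn : n ≠ 0) {σX σY : ℝ} (hσX : σX ≠ 0) (hσY : σY ≠ 0)
    (μX μY ρ t x : ℝ) :
    (A1 n μX μY σX σY ρ (trig t 1 0) x : ℂ) + I * A1 n μX μY σX σY ρ (trig t 0 1) x
      = (den (σX * σY) ρ ((n : ℝ)⁻¹ * t) ^ 2 * x
          + I * logDerivNum μX μY σX σY ρ ((n : ℝ)⁻¹ * t)) * cexp (t * x * I) := by
  have hn' : (n : ℂ) ≠ 0 := by exact_mod_cast hn
  have hX : (σX : ℂ) ≠ 0 := by exact_mod_cast hσX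
  have hY : (σY : ℂ) ≠ 0 := by exact_mod_cast hσY
  unfold A1
  simp only [iteratedDeriv_trig_succ, iteratedDeriv_zero]
  unfold trig den logDerivNum
  rw [exp_mul_I]
  push_cast
  set s := Complex.sin (t * x)
  set k := Complex.cos (t * x)
  clear_value s k
  field_simp
  have hI := I_sq
  clear * - hI
  grind

lemma hasDerivAt_charFun {ν : Measure ℝ} [IsFiniteMeasure ν] (h : Integrable id ν) (t : ℝ) :
    HasDerivAt (charFun ν) (I * ∫ x, x * cexp (t * x * I) ∂ν) t := by
  have hm : MemLp id ((1 : ℕ) : ENNReal) ν := by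
    rw [Nat.cast_one]
    exact memLp_one_iff_integrable.2 h
  have hd : DifferentiableAt ℝ (charFun ν) t :=
    ((contDiff_charFun hm).differentiable (by simp)).differentiableAt
  have h1 := iteratedDeriv_charFun (t := t) hm
  rw [iteratedDeriv_one, pow_one] at h1
  simpa [h1] using hd.hasDerivAt

/-- Two solutions of `φ' = φ * a`, one of which vanishes nowhere, agree if they agree at `0`. -/
lemma eq_of_hasDerivAt_mul {φ χ a : ℝ → ℂ} (hφ : ∀ t, HasDerivAt φ (φ t * a t) t)
    (hχ : ∀ t, HasDerivAt χ (χ t * a t) t) (h0 : ∀ t, χ t ≠ 0) (h : φ 0 = χ 0) : φ = χ := by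
  have hq : ∀ t, HasDerivAt (fun s => φ s / χ s) 0 t := fun t => by
    refine ((hφ t).fun_div (hχ t) (h0 t)).congr_deriv ?_
    rw [div_eq_zero_iff]
    left
    ring
  have hconst := is_const_of_deriv_eq_zero (fun t => (hq t).differentiableAt)
    (fun t => (hq t).deriv)
  ext t
  have := hconst t 0
  rw [h, div_self (h0 0), div_eq_one_iff_eq (h0 t)] at this
  exact this

lemma hasDerivAt_charFun_PNbar {ρ : ℝ} (hρ₁ : -1 < ρ) (hρ₂ : ρ < 1) {n : ℕ} (hn : n ≠ 0)
    (μX μY σX σY t : ℝ) :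
    HasDerivAt (charFun (PNbar n μX μY σX σY ρ)) (charFun (PNbar n μX μY σX σY ρ) t *
      (logDerivNum μX μY σX σY ρ ((n : ℝ)⁻¹ * t) / den (σX * σY) ρ ((n : ℝ)⁻¹ * t) ^ 2)) t := by
  have hn' : (n : ℂ) ≠ 0 := by exact_mod_cast hn
  rw [funext (charFun_PNbar hρ₁ hρ₂ n μX μY σX σY)]
  have h1 : HasDerivAt (fun s : ℝ => (n : ℝ)⁻¹ * s) ((n : ℝ)⁻¹) t := by
    simpa using (hasDerivAt_id t).const_mul ((n : ℝ)⁻¹)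
  have h2 := ((hasDerivAt_closedForm hρ₁ hρ₂ μX μY σX σY ((n : ℝ)⁻¹ * t)).scomp t h1).fun_pow n
  refine h2.congr_deriv ?_
  obtain ⟨m, rfl⟩ := Nat.exists_eq_succ_of_ne_zero hn
  simp only [Function.comp_apply, real_smul, Nat.succ_eq_add_one, Nat.add_sub_cancel]
  push_cast at hn' ⊢
  field_simp
  ring

end ProductNormal

/-- Sufficiency part of the Stein characterisation: if `W` is an integrable real random variable
such that `E[A₁ f (W)] = 0` for every `C⁴` function `f` satisfying the integrability conditions
`E|f⁽ᵐ⁾(Z̄ₙ)| < ∞` for `m = 0,1,2,3` and `E|Z̄ₙ f⁽ᵐ⁾(Z̄ₙ)| < ∞` for `m = 0,1,2,3,4`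
(and for which the left-hand side is defined), then `W` is distributed as `Z̄ₙ`, the mean of `n`
independent `PN(μX, μY; σX², σY²; ρ)` random variables. -/
theorem stein_sufficiency_PNbar
    {Ω : Type*} [MeasurableSpace Ω] (P : Measure Ω) [IsProbabilityMeasure P]
    (μX μY σX σY ρ : ℝ) (hσX : 0 < σX) (hσY : 0 < σY)
    (hρ₁ : -1 < ρ) (hρ₂ : ρ < 1) (n : ℕ) (hn : 1 ≤ n)
    (W : Ω → ℝ) (hW : Measurable W) (hWint : Integrable W P)
    (hstein : ∀ f : ℝ → ℝ, ContDiff ℝ 4 f →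
      (∀ m ≤ 3, Integrable (iteratedDeriv m f) (PNbar n μX μY σX σY ρ)) →
      (∀ m ≤ 4, Integrable (fun x => x * iteratedDeriv m f x) (PNbar n μX μY σX σY ρ)) →
      Integrable (fun ω => A1 n μX μY σX σY ρ f (W ω)) P →
      ∫ ω, A1 n μX μY σX σY ρ f (W ω) ∂P = 0) :
    Measure.map W P = PNbar n μX μY σX σY ρ := by
  have hn' : n ≠ 0 := by omega
  have : IsProbabilityMeasure (P.map W) := Measure.isProbabilityMeasure_map hW.aemeasurable
  have hWid : Integrable id (P.map W) := by
    rw [integrable_map_measure (by fun_prop) hW.aemeasurable]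
    exact hWint
  have hid := ProductNormal.integrable_id_PNbar n μX μY σX σY ρ
  have htrig : ∀ t α β : ℝ, ∫ ω, A1 n μX μY σX σY ρ (ProductNormal.trig t α β) (W ω) ∂P = 0 := by
    intro t α β
    refine hstein _ (ProductNormal.contDiff_trig t α β 4) (fun m _ => ?_) (fun m _ => ?_)
      (ProductNormal.integrable_A1_trig hW hWint n μX μY σX σY ρ t α β)
    all_goals
      obtain ⟨α', β', h⟩ := ProductNormal.exists_iteratedDeriv_trig m t α β
      rw [h]
    · exact ProductNormal.integrable_trig_comp measurable_id t α' β'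
    · exact ProductNormal.integrable_mul_trig_comp measurable_id hid t α' β'
  have hode : ∀ t : ℝ, ProductNormal.den (σX * σY) ρ ((n : ℝ)⁻¹ * t) ^ 2
      * ∫ x, x * Complex.exp (t * x * Complex.I) ∂(P.map W) + Complex.I
      * ProductNormal.logDerivNum μX μY σX σY ρ ((n : ℝ)⁻¹ * t) * charFun (P.map W) t = 0 := by
    intro t
    have hexp : Integrable (fun x : ℝ => Complex.exp (t * x * Complex.I)) (P.map W) := by
      refine Integrable.of_bound (by fun_prop) 1 (ae_of_all _ fun x => ?_)
      rw [← Complex.ofReal_mul, Complex.norm_exp_ofReal_mul_I]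
    have hmul : Integrable (fun x : ℝ => (x : ℂ) * Complex.exp (t * x * Complex.I)) (P.map W) := by
      refine hWid.ofReal.mul_bdd (c := 1) (by fun_prop) (ae_of_all _ fun x => ?_)
      rw [← Complex.ofReal_mul, Complex.norm_exp_ofReal_mul_I]
    rw [charFun_apply_real, ← integral_const_mul, ← integral_const_mul,
      ← integral_add (hmul.const_mul _) (hexp.const_mul _),
      integral_map hW.aemeasurable (by fun_prop)]
    have hA : ∀ α β : ℝ, Integrable
        (fun ω => (A1 n μX μY σX σY ρ (ProductNormal.trig t α β) (W ω) : ℂ)) P := fun α β =>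
      (ProductNormal.integrable_A1_trig hW hWint n μX μY σX σY ρ t α β).ofReal
    calc _ = ∫ ω, ((A1 n μX μY σX σY ρ (ProductNormal.trig t 1 0) (W ω) : ℂ)
          + Complex.I * A1 n μX μY σX σY ρ (ProductNormal.trig t 0 1) (W ω)) ∂P := by
          refine integral_congr_ae (ae_of_all _ fun ω => ?_)
          simp only [ProductNormal.A1_trig hn' hσX.ne' hσY.ne']
          ring
      _ = 0 := by
          rw [integral_add (hA 1 0) ((hA 0 1).const_mul _), integral_const_mul]
          rw [integral_complex_ofReal, integral_complex_ofReal, htrig, htrig]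
          simp
  refine Measure.ext_of_charFun (ProductNormal.eq_of_hasDerivAt_mul (fun t => ?_)
    (ProductNormal.hasDerivAt_charFun_PNbar hρ₁ hρ₂ hn' μX μY σX σY) (fun t => ?_) ?_)
  · refine (ProductNormal.hasDerivAt_charFun hWid t).congr_deriv ?_
    have hd := ProductNormal.den_ne_zero hρ₁ hρ₂ (σX * σY) ((n : ℝ)⁻¹ * t)
    have h := hode t
    rw [mul_div_assoc', eq_div_iff (pow_ne_zero 2 hd)]
    linear_combination Complex.I * h - ProductNormal.logDerivNum μX μY σX σY ρ ((n : ℝ)⁻¹ * t)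
      * charFun (P.map W) t * Complex.I_sq
  · rw [ProductNormal.charFun_PNbar hρ₁ hρ₂]
    exact pow_ne_zero _ (ProductNormal.closedForm_ne_zero hρ₁ hρ₂ _ _ _ _ _)
  · simp [charFun_zero]
end

section
/- Suppose μ_X/σ_X = μ_Y/σ_Y, and let Z have the law PN(μ_X,μ_Y;σ_X²,σ_Y²;ρ). Then for every function f : ℝ → ℝ of class C³ such that E|f^{(m)}(Z)| < ∞ for m = 0,1,2 and E|Z·f^{(m)}(Z)| < ∞ for m = 0,1,2,3, one has E[A₂f(Z)] = 0, where (writing s = σ_Xσ_Y) A₂f(x) = s³(1−ρ²)(1+ρ)·x·f‴(x) + s²(1+ρ)(s(1−ρ²)+(3ρ−1)x)·f″(x) + s(s(2ρ²+ρ−1−(1−ρ)r_Xr_Y)−(3ρ+1)x)·f′(x) + (x−sρ−μ_Xμ_Y)·f(x). -/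
open MeasureTheory ProbabilityTheory

/-- The third-order Stein operator `A₂` (with `s_n = σXσY/n`, `r_X = μX/σX`, `r_Y = μY/σY`). -/
noncomputable def A2 (n : ℕ) (μX μY σX σY ρ : ℝ) (f : ℝ → ℝ) (x : ℝ) : ℝ :=
  (σX * σY / (n : ℝ)) ^ 3 * (1 - ρ ^ 2) * (1 + ρ) * x * iteratedDeriv 3 f x
    + (σX * σY / (n : ℝ)) ^ 2 * (1 + ρ)
        * ((n : ℝ) * (σX * σY / (n : ℝ)) * (1 - ρ ^ 2) + (3 * ρ - 1) * x) * iteratedDeriv 2 f x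
    + (σX * σY / (n : ℝ))
        * ((n : ℝ) * (σX * σY / (n : ℝ))
              * (2 * ρ ^ 2 + ρ - 1 - (1 - ρ) * (μX / σX) * (μY / σY))
            - (3 * ρ + 1) * x) * iteratedDeriv 1 f x
    + (x - (n : ℝ) * (σX * σY / (n : ℝ)) * ρ - μX * μY) * f x


/-- Continuous functions on the plane of at most polynomial growth. -/
def PolyGrowth (G : ℝ × ℝ → ℝ) : Prop :=
  Continuous G ∧ ∃ (C : ℝ) (n : ℕ), ∀ p, |G p| ≤ C * ((1 + p.1 ^ 2) ^ n * (1 + p.2 ^ 2) ^ n)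

namespace PolyGrowth

variable {G H : ℝ × ℝ → ℝ}

lemma const (c : ℝ) : PolyGrowth fun _ => c :=
  ⟨continuous_const, |c|, 0, fun p => by simp⟩

lemma fst : PolyGrowth fun p => p.1 := by
  refine ⟨continuous_fst, 1, 1, fun p => abs_le.2 ⟨?_, ?_⟩⟩ <;>
    nlinarith [sq_nonneg (p.1 * p.2), sq_nonneg p.2, sq_nonneg (p.1 + 1), sq_nonneg (p.1 - 1)]

lemma snd : PolyGrowth fun p => p.2 := by
  refine ⟨continuous_snd, 1, 1, fun p => abs_le.2 ⟨?_, ?_⟩⟩ <;>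
    nlinarith [sq_nonneg (p.1 * p.2), sq_nonneg p.1, sq_nonneg (p.2 + 1), sq_nonneg (p.2 - 1)]

lemma mul (hG : PolyGrowth G) (hH : PolyGrowth H) : PolyGrowth fun p => G p * H p := by
  obtain ⟨hGc, C, n, hC⟩ := hG
  obtain ⟨hHc, D, m, hD⟩ := hH
  refine ⟨hGc.mul hHc, C * D, n + m, fun p => ?_⟩
  rw [abs_mul]
  calc |G p| * |H p| ≤ _ :=
        mul_le_mul (hC p) (hD p) (abs_nonneg _) ((abs_nonneg _).trans (hC p))
    _ = _ := by ring

lemma add (hG : PolyGrowth G) (hH : PolyGrowth H) : PolyGrowth fun p => G p + H p := by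
  obtain ⟨hGc, C, n, hC⟩ := hG
  obtain ⟨hHc, D, m, hD⟩ := hH
  have hC0 : 0 ≤ C := by simpa using (abs_nonneg _).trans (hC 0)
  have hD0 : 0 ≤ D := by simpa using (abs_nonneg _).trans (hD 0)
  refine ⟨hGc.add hHc, C + D, max n m, fun p => ?_⟩
  have h1 : 1 ≤ 1 + p.1 ^ 2 := by nlinarith
  have h2 : 1 ≤ 1 + p.2 ^ 2 := by nlinarith
  calc |G p + H p| ≤ |G p| + |H p| := abs_add_le _ _
    _ ≤ C * ((1 + p.1 ^ 2) ^ n * (1 + p.2 ^ 2) ^ n)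
        + D * ((1 + p.1 ^ 2) ^ m * (1 + p.2 ^ 2) ^ m) := add_le_add (hC p) (hD p)
    _ ≤ C * ((1 + p.1 ^ 2) ^ max n m * (1 + p.2 ^ 2) ^ max n m)
        + D * ((1 + p.1 ^ 2) ^ max n m * (1 + p.2 ^ 2) ^ max n m) := by
        gcongr
        exacts [le_max_left _ _, le_max_left _ _, le_max_right _ _, le_max_right _ _]
    _ = _ := by ring

lemma sub (hG : PolyGrowth G) (hH : PolyGrowth H) : PolyGrowth fun p => G p - H p := by
  simpa [sub_eq_add_neg] using hG.add ((const (-1)).mul hH)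

lemma pow (hG : PolyGrowth G) (n : ℕ) : PolyGrowth fun p => G p ^ n := by
  induction n with
  | zero => simpa using const 1
  | succ n ih => simpa [pow_succ] using ih.mul hG

lemma comp_bounded (hG : PolyGrowth G) {h : ℝ → ℝ} (hc : Continuous h) {C : ℝ}
    (hb : ∀ x, |h x| ≤ C) : PolyGrowth fun p => h (G p) :=
  ⟨hc.comp hG.1, C, 0, fun p => by simpa using hb (G p)⟩

lemma swap (hG : PolyGrowth G) : PolyGrowth fun p => G p.swap := by
  obtain ⟨hGc, C, n, hC⟩ := hG
  exact ⟨hGc.comp continuous_swap, C, n, fun p => by simpa [mul_comm] using hC p.swap⟩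

end PolyGrowth

lemma integrable_pow_gaussianReal (n : ℕ) :
    Integrable (fun u : ℝ => u ^ n) (gaussianReal 0 1) := by
  rcases eq_or_ne n 0 with rfl | hn
  · simp
  have h : MemLp (id : ℝ → ℝ) n (gaussianReal 0 1) := by
    exact_mod_cast memLp_id_gaussianReal (μ := 0) (v := 1) (n : NNReal)
  have h' := h.integrable_norm_pow hn
  refine (integrable_norm_iff (by fun_prop)).1 ?_
  simpa [norm_pow] using h'

lemma integrable_one_add_sq_pow_gaussianReal (n : ℕ) :
    Integrable (fun u : ℝ => (1 + u ^ 2) ^ n) (gaussianReal 0 1) := by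
  simp only [add_pow, one_pow, one_mul, ← pow_mul]
  exact integrable_finsetSum _ fun i _ => (integrable_pow_gaussianReal _).mul_const _

lemma PolyGrowth.integrable {G : ℝ × ℝ → ℝ} (hG : PolyGrowth G) :
    Integrable G ((gaussianReal 0 1).prod (gaussianReal 0 1)) := by
  obtain ⟨hGc, C, n, hC⟩ := hG
  have := integrable_one_add_sq_pow_gaussianReal n
  exact ((this.mul_prod this).const_mul C).mono' hGc.aestronglyMeasurable
    (Filter.Eventually.of_forall fun p => hC p)

lemma PolyGrowth.integrable_slice {G : ℝ × ℝ → ℝ} (hG : PolyGrowth G) (y : ℝ) :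
    Integrable (fun x => G (x, y)) (gaussianReal 0 1) := by
  obtain ⟨hGc, C, n, hC⟩ := hG
  have := integrable_one_add_sq_pow_gaussianReal n
  exact ((this.mul_const ((1 + y ^ 2) ^ n)).const_mul C).mono' (by fun_prop)
    (Filter.Eventually.of_forall fun p => hC (p, y))

lemma hasDerivAt_gaussianPDFReal (x : ℝ) :
    HasDerivAt (gaussianPDFReal 0 1) (-(x * gaussianPDFReal 0 1 x)) x := by
  have h : HasDerivAt (fun x : ℝ => -(x - 0) ^ 2 / (2 * ((1 : NNReal) : ℝ))) (-x) x := by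
    have := (((hasDerivAt_id' x).sub_const 0).pow 2).neg.div_const (2 * ((1 : NNReal) : ℝ))
    refine this.congr_deriv ?_
    simp only [NNReal.coe_one]
    push_cast
    ring
  rw [gaussianPDFReal_def]
  refine ((h.exp).const_mul ((√(2 * Real.pi * ((1 : NNReal) : ℝ)))⁻¹)).congr_deriv ?_
  ring

lemma integrable_gaussianReal_iff {g : ℝ → ℝ} :
    Integrable g (gaussianReal 0 1) ↔ Integrable fun x => gaussianPDFReal 0 1 x * g x := by
  rw [gaussianReal_of_var_ne_zero 0 one_ne_zero,
    integrable_withDensity_iff_integrable_smul' (measurable_gaussianPDF 0 1)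
      (Filter.Eventually.of_forall fun _ => gaussianPDF_lt_top)]
  simp [toReal_gaussianPDF]

/-- Stein's identity for the standard normal law. -/
lemma integral_id_mul_gaussianReal_s3 {g g' : ℝ → ℝ} (hd : ∀ x, HasDerivAt g (g' x) x)
    (hg : Integrable g (gaussianReal 0 1)) (hg' : Integrable g' (gaussianReal 0 1))
    (hxg : Integrable (fun x => x * g x) (gaussianReal 0 1)) :
    ∫ x, x * g x ∂gaussianReal 0 1 = ∫ x, g' x ∂gaussianReal 0 1 := by
  rw [integral_gaussianReal_eq_integral_smul one_ne_zero,
    integral_gaussianReal_eq_integral_smul one_ne_zero]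
  rw [integrable_gaussianReal_iff] at hg hg' hxg
  have key := integral_mul_deriv_eq_deriv_mul_of_integrable (u := g) (u' := g')
    (v := gaussianPDFReal 0 1) (v' := fun x => -(x * gaussianPDFReal 0 1 x))
    (fun x _ => hd x) (fun x _ => hasDerivAt_gaussianPDFReal x)
    (by refine hxg.neg.congr (Filter.Eventually.of_forall fun x => ?_)
        simp only [Pi.neg_apply, Pi.mul_apply]; ring)
    (by refine hg'.congr (Filter.Eventually.of_forall fun x => ?_)
        simp only [Pi.mul_apply]; ring)
    (by refine hg.congr (Filter.Eventually.of_forall fun x => ?_)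
        simp only [Pi.mul_apply]; ring)
  calc ∫ x, gaussianPDFReal 0 1 x • (x * g x)
      = -∫ x, g x * -(x * gaussianPDFReal 0 1 x) := by
        rw [← integral_neg]; congr 1; ext x; simp only [smul_eq_mul]; ring
    _ = ∫ x, g' x * gaussianPDFReal 0 1 x := by rw [key, neg_neg]
    _ = _ := by congr 1; ext x; simp only [smul_eq_mul]; ring

local notation "γ₂" => (Measure.prod (gaussianReal 0 1) (gaussianReal 0 1) : Measure (ℝ × ℝ))

lemma integral_fst_mul_gaussian_prod {G G' : ℝ × ℝ → ℝ} (hG : PolyGrowth G) (hG' : PolyGrowth G')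
    (hd : ∀ x y, HasDerivAt (fun t => G (t, y)) (G' (x, y)) x) :
    ∫ p, p.1 * G p ∂γ₂ = ∫ p, G' p ∂γ₂ := by
  have h1 := PolyGrowth.fst.mul hG
  rw [integral_prod_symm _ h1.integrable, integral_prod_symm _ hG'.integrable]
  congr 1
  ext y
  exact integral_id_mul_gaussianReal_s3 (fun x => hd x y) (hG.integrable_slice y)
    (hG'.integrable_slice y) (h1.integrable_slice y)

lemma integral_snd_mul_gaussian_prod {G G' : ℝ × ℝ → ℝ} (hG : PolyGrowth G) (hG' : PolyGrowth G')
    (hd : ∀ x y, HasDerivAt (fun t => G (x, t)) (G' (x, y)) y) :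
    ∫ p, p.2 * G p ∂γ₂ = ∫ p, G' p ∂γ₂ := by
  rw [← integral_prod_swap, ← integral_prod_swap (f := G')]
  exact integral_fst_mul_gaussian_prod hG.swap hG'.swap fun x y => hd y x

/-- Gaussian integration by parts in the direction `(A, B)`. -/
lemma integral_linear_mul_gaussian_prod (A B : ℝ) {G G₁ G₂ : ℝ × ℝ → ℝ} (hG : PolyGrowth G)
    (hG₁ : PolyGrowth G₁) (hG₂ : PolyGrowth G₂)
    (hd₁ : ∀ x y, HasDerivAt (fun t => G (t, y)) (G₁ (x, y)) x)
    (hd₂ : ∀ x y, HasDerivAt (fun t => G (x, t)) (G₂ (x, y)) y) :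
    ∫ p, (A * p.1 + B * p.2) * G p ∂γ₂ = ∫ p, A * G₁ p + B * G₂ p ∂γ₂ := by
  rw [integral_add (hG₁.integrable.const_mul A) (hG₂.integrable.const_mul B),
    integral_const_mul, integral_const_mul, ← integral_fst_mul_gaussian_prod hG hG₁ hd₁,
    ← integral_snd_mul_gaussian_prod hG hG₂ hd₂, ← integral_const_mul, ← integral_const_mul,
    ← integral_add ((PolyGrowth.fst.mul hG).integrable.const_mul A)
      ((PolyGrowth.snd.mul hG).integrable.const_mul B)]
  congr 1
  ext p
  ring

section SquareDifference

variable {s r A B C D : ℝ} {h h' : ℝ → ℝ}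

/-- The linear form `r + A u + B v`. -/
def affineForm (r A B : ℝ) (p : ℝ × ℝ) : ℝ := r + (A * p.1 + B * p.2)

lemma polyGrowth_affineForm (r A B : ℝ) : PolyGrowth (affineForm r A B) :=
  (PolyGrowth.const r).add
    (((PolyGrowth.const A).mul .fst).add ((PolyGrowth.const B).mul .snd))

lemma hasDerivAt_affineForm_fst (r A B x y : ℝ) :
    HasDerivAt (fun t => affineForm r A B (t, y)) A x := by
  simpa [affineForm] using ((((hasDerivAt_id' x).const_mul A).add_const (B * y)).const_add r)

lemma hasDerivAt_affineForm_snd (r A B x y : ℝ) :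
    HasDerivAt (fun t => affineForm r A B (x, t)) B y := by
  simpa [affineForm] using ((((hasDerivAt_id' y).const_mul B).const_add (A * x)).const_add r)

/-- The quadratic form `s (P² - Q²)` with `P = r + A u + B v` and `Q = C u + D v`. -/
def squareDiff (s r A B C D : ℝ) (p : ℝ × ℝ) : ℝ :=
  s * (affineForm r A B p ^ 2 - affineForm 0 C D p ^ 2)

lemma polyGrowth_squareDiff (s r A B C D : ℝ) : PolyGrowth (squareDiff s r A B C D) :=
  (PolyGrowth.const s).mul
    (((polyGrowth_affineForm r A B).pow 2).sub ((polyGrowth_affineForm 0 C D).pow 2))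

lemma hasDerivAt_squareDiff_fst (s r A B C D x y : ℝ) :
    HasDerivAt (fun t => squareDiff s r A B C D (t, y))
      (2 * s * (A * affineForm r A B (x, y) - C * affineForm 0 C D (x, y))) x := by
  have := ((((hasDerivAt_affineForm_fst r A B x y).pow 2).sub
    ((hasDerivAt_affineForm_fst 0 C D x y).pow 2)).const_mul s)
  refine this.congr_deriv ?_
  push_cast
  ring

lemma hasDerivAt_squareDiff_snd (s r A B C D x y : ℝ) :
    HasDerivAt (fun t => squareDiff s r A B C D (x, t))
      (2 * s * (B * affineForm r A B (x, y) - D * affineForm 0 C D (x, y))) y := by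
  have := ((((hasDerivAt_affineForm_snd r A B x y).pow 2).sub
    ((hasDerivAt_affineForm_snd 0 C D x y).pow 2)).const_mul s)
  refine this.congr_deriv ?_
  push_cast
  ring

local notation "P" => affineForm r A B
local notation "Q" => affineForm 0 C D
local notation "W" => squareDiff s r A B C D

lemma integral_affineForm_mul_comp_squareDiff (hd : ∀ x, HasDerivAt h (h' x) x)
    (hg : ∀ {G}, PolyGrowth G → PolyGrowth fun p => h (G p))
    (hg' : ∀ {G}, PolyGrowth G → PolyGrowth fun p => h' (G p)) (hAB : A * C + B * D = 0) :
    ∫ p, P p * h (W p) ∂γ₂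
      = r * ∫ p, h (W p) ∂γ₂ + 2 * s * (A ^ 2 + B ^ 2) * ∫ p, P p * h' (W p) ∂γ₂ := by
  have hP := polyGrowth_affineForm r A B
  have hQ := polyGrowth_affineForm 0 C D
  have hW := polyGrowth_squareDiff s r A B C D
  have hl : PolyGrowth fun p => A * p.1 + B * p.2 :=
    ((PolyGrowth.const A).mul .fst).add ((PolyGrowth.const B).mul .snd)
  have key := integral_linear_mul_gaussian_prod A B (hg hW)
    ((hg' hW).mul ((PolyGrowth.const (2 * s)).mul
      (((PolyGrowth.const A).mul hP).sub ((PolyGrowth.const C).mul hQ))))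
    ((hg' hW).mul ((PolyGrowth.const (2 * s)).mul
      (((PolyGrowth.const B).mul hP).sub ((PolyGrowth.const D).mul hQ))))
    (fun x y => (hd _).comp x (hasDerivAt_squareDiff_fst s r A B C D x y))
    (fun x y => (hd _).comp y (hasDerivAt_squareDiff_snd s r A B C D x y))
  calc ∫ p, P p * h (W p) ∂γ₂
      = ∫ p, r * h (W p) + (A * p.1 + B * p.2) * h (W p) ∂γ₂ := by
        congr 1; ext p; simp only [affineForm]; ring
    _ = r * ∫ p, h (W p) ∂γ₂ + ∫ p, (A * p.1 + B * p.2) * h (W p) ∂γ₂ := by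
        rw [integral_add ((hg hW).integrable.const_mul r) (hl.mul (hg hW)).integrable,
          integral_const_mul]
    _ = _ := by
        rw [key, ← integral_const_mul (2 * s * (A ^ 2 + B ^ 2))]
        congr 2
        ext p
        linear_combination (-2 * s * h' (W p) * Q p) * hAB

lemma integral_affineForm_sq_mul_comp_squareDiff (hd : ∀ x, HasDerivAt h (h' x) x)
    (hg : ∀ {G}, PolyGrowth G → PolyGrowth fun p => h (G p))
    (hg' : ∀ {G}, PolyGrowth G → PolyGrowth fun p => h' (G p)) (hAB : A * C + B * D = 0) :
    ∫ p, P p ^ 2 * h (W p) ∂γ₂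
      = r * ∫ p, P p * h (W p) ∂γ₂ + (A ^ 2 + B ^ 2) * ∫ p, h (W p) ∂γ₂
        + 2 * s * (A ^ 2 + B ^ 2) * ∫ p, P p ^ 2 * h' (W p) ∂γ₂ := by
  have hP := polyGrowth_affineForm r A B
  have hQ := polyGrowth_affineForm 0 C D
  have hW := polyGrowth_squareDiff s r A B C D
  have hl : PolyGrowth fun p => A * p.1 + B * p.2 :=
    ((PolyGrowth.const A).mul .fst).add ((PolyGrowth.const B).mul .snd)
  have key := integral_linear_mul_gaussian_prod A B (hP.mul (hg hW))
    (((PolyGrowth.const A).mul (hg hW)).add (hP.mul ((hg' hW).mul ((PolyGrowth.const (2 * s)).mul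
      (((PolyGrowth.const A).mul hP).sub ((PolyGrowth.const C).mul hQ))))))
    (((PolyGrowth.const B).mul (hg hW)).add (hP.mul ((hg' hW).mul ((PolyGrowth.const (2 * s)).mul
      (((PolyGrowth.const B).mul hP).sub ((PolyGrowth.const D).mul hQ))))))
    (fun x y => (hasDerivAt_affineForm_fst r A B x y).mul
      ((hd _).comp x (hasDerivAt_squareDiff_fst s r A B C D x y)))
    (fun x y => (hasDerivAt_affineForm_snd r A B x y).mul
      ((hd _).comp y (hasDerivAt_squareDiff_snd s r A B C D x y)))
  calc ∫ p, P p ^ 2 * h (W p) ∂γ₂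
      = ∫ p, r * (P p * h (W p)) + (A * p.1 + B * p.2) * (P p * h (W p)) ∂γ₂ := by
        congr 1; ext p; simp only [affineForm]; ring
    _ = r * ∫ p, P p * h (W p) ∂γ₂ + ∫ p, (A * p.1 + B * p.2) * (P p * h (W p)) ∂γ₂ := by
        rw [integral_add ((hP.mul (hg hW)).integrable.const_mul r)
          (hl.mul (hP.mul (hg hW))).integrable, integral_const_mul]
    _ = _ := by
        rw [key, add_assoc, ← integral_const_mul (2 * s * (A ^ 2 + B ^ 2)),
          ← integral_const_mul (A ^ 2 + B ^ 2), ← integral_add ((hg hW).integrable.const_mul _)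
            (((hP.pow 2).mul (hg' hW)).integrable.const_mul _)]
        congr 2
        ext p
        linear_combination (-2 * s * P p * h' (W p) * Q p) * hAB

lemma integral_affineForm_zero_sq_mul_comp_squareDiff (hd : ∀ x, HasDerivAt h (h' x) x)
    (hg : ∀ {G}, PolyGrowth G → PolyGrowth fun p => h (G p))
    (hg' : ∀ {G}, PolyGrowth G → PolyGrowth fun p => h' (G p)) (hAB : A * C + B * D = 0) :
    ∫ p, Q p ^ 2 * h (W p) ∂γ₂
      = (C ^ 2 + D ^ 2) * ∫ p, h (W p) ∂γ₂
        - 2 * s * (C ^ 2 + D ^ 2) * ∫ p, Q p ^ 2 * h' (W p) ∂γ₂ := by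
  have hP := polyGrowth_affineForm r A B
  have hQ := polyGrowth_affineForm 0 C D
  have hW := polyGrowth_squareDiff s r A B C D
  have key := integral_linear_mul_gaussian_prod C D (hQ.mul (hg hW))
    (((PolyGrowth.const C).mul (hg hW)).add (hQ.mul ((hg' hW).mul ((PolyGrowth.const (2 * s)).mul
      (((PolyGrowth.const A).mul hP).sub ((PolyGrowth.const C).mul hQ))))))
    (((PolyGrowth.const D).mul (hg hW)).add (hQ.mul ((hg' hW).mul ((PolyGrowth.const (2 * s)).mul
      (((PolyGrowth.const B).mul hP).sub ((PolyGrowth.const D).mul hQ))))))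
    (fun x y => (hasDerivAt_affineForm_fst 0 C D x y).mul
      ((hd _).comp x (hasDerivAt_squareDiff_fst s r A B C D x y)))
    (fun x y => (hasDerivAt_affineForm_snd 0 C D x y).mul
      ((hd _).comp y (hasDerivAt_squareDiff_snd s r A B C D x y)))
  calc ∫ p, Q p ^ 2 * h (W p) ∂γ₂
      = ∫ p, (C * p.1 + D * p.2) * (Q p * h (W p)) ∂γ₂ := by
        congr 1; ext p; simp only [affineForm]; ring
    _ = _ := by
        rw [key, ← integral_const_mul (2 * s * (C ^ 2 + D ^ 2)),
          ← integral_const_mul (C ^ 2 + D ^ 2), ← integral_sub ((hg hW).integrable.const_mul _)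
            (((hQ.pow 2).mul (hg' hW)).integrable.const_mul _)]
        congr 1
        ext p
        linear_combination (2 * s * P p * h' (W p) * Q p) * hAB

end SquareDifference

lemma HasCompactSupport.iteratedDeriv {f : ℝ → ℝ} (hf : HasCompactSupport f) (m : ℕ) :
    HasCompactSupport (iteratedDeriv m f) := by
  induction m with
  | zero => simpa using hf
  | succ m ih => rw [iteratedDeriv_succ]; exact ih.deriv

lemma PN_eq_map_squareDiff {μX μY σX σY ρ : ℝ} (hσX : σX ≠ 0) (hσY : σY ≠ 0)
    (heq : μX / σX = μY / σY) :
    PN μX μY σX σY ρ = Measure.map (squareDiff (σX * σY) (μX / σX) ((1 + ρ) / 2)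
      (√(1 - ρ ^ 2) / 2) ((1 - ρ) / 2) (-√(1 - ρ ^ 2) / 2)) γ₂ := by
  have hX : μX = μX / σX * σX := by field_simp
  have hY : μY = μX / σX * σY := by rw [heq]; field_simp
  generalize μX / σX = r at hX hY ⊢
  subst hX hY
  unfold PN
  congr 1
  ext p
  simp only [squareDiff, affineForm]
  ring

lemma integral_A2_of_hasCompactSupport {μX μY σX σY ρ : ℝ} (hσX : 0 < σX) (hσY : 0 < σY)
    (hρ : 0 ≤ 1 - ρ ^ 2) (heq : μX / σX = μY / σY) {f : ℝ → ℝ} (hf : ContDiff ℝ 3 f)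
    (hs : HasCompactSupport f) :
    ∫ x, A2 1 μX μY σX σY ρ f x ∂(PN μX μY σX σY ρ) = 0 := by
  have hcont : ∀ m ≤ 3, Continuous (iteratedDeriv m f) := fun m hm =>
    hf.continuous_iteratedDeriv m (by exact_mod_cast hm)
  have hder : ∀ m < 3, ∀ x, HasDerivAt (iteratedDeriv m f) (iteratedDeriv (m + 1) f x) x := by
    intro m hm x
    rw [iteratedDeriv_succ]
    exact (hf.differentiable_iteratedDeriv m (by exact_mod_cast hm) x).hasDerivAt
  have hgrow : ∀ m ≤ 3, ∀ {G}, PolyGrowth G → PolyGrowth fun p => iteratedDeriv m f (G p) := by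
    intro m hm G hG
    obtain ⟨C, hC⟩ := (hs.iteratedDeriv m).exists_bound_of_continuous (hcont m hm)
    exact hG.comp_bounded (hcont m hm) hC
  have hA2 : Continuous (A2 1 μX μY σX σY ρ f) := by
    have h0 := hcont 0 (by norm_num)
    rw [iteratedDeriv_zero] at h0
    have h1 := hcont 1 (by norm_num)
    have h2 := hcont 2 (by norm_num)
    have h3 := hcont 3 (by norm_num)
    unfold A2
    fun_prop
  rw [PN_eq_map_squareDiff hσX.ne' hσY.ne' heq]
  set s := σX * σY with hs_def
  set r := μX / σX with hr
  set c := √(1 - ρ ^ 2) with hc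
  have hc2 : c ^ 2 = 1 - ρ ^ 2 := Real.sq_sqrt hρ
  have hAB : (1 + ρ) / 2 * ((1 - ρ) / 2) + c / 2 * (-c / 2) = 0 := by
    linear_combination (-1 / 4) * hc2
  have hα : ((1 + ρ) / 2) ^ 2 + (c / 2) ^ 2 = (1 + ρ) / 2 := by linear_combination (1 / 4) * hc2
  have hβ : ((1 - ρ) / 2) ^ 2 + (-c / 2) ^ 2 = (1 - ρ) / 2 := by linear_combination (1 / 4) * hc2
  have hμ : μX * μY = s * r * r := by
    nth_rewrite 2 [heq]
    rw [hr, hs_def]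
    field_simp
  have L1 := fun m (hm : m < 3) => integral_affineForm_mul_comp_squareDiff (s := s) (r := r)
    (hder m hm) (hgrow m hm.le) (hgrow (m + 1) hm) hAB
  have L2 := fun m (hm : m < 3) => integral_affineForm_sq_mul_comp_squareDiff (s := s) (r := r)
    (hder m hm) (hgrow m hm.le) (hgrow (m + 1) hm) hAB
  have L3 := fun m (hm : m < 3) => integral_affineForm_zero_sq_mul_comp_squareDiff (s := s) (r := r)
    (hder m hm) (hgrow m hm.le) (hgrow (m + 1) hm) hAB
  rw [hα] at L1 L2
  rw [hβ] at L3
  have hP := polyGrowth_affineForm r ((1 + ρ) / 2) (c / 2)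
  have hQ := polyGrowth_affineForm 0 ((1 - ρ) / 2) (-c / 2)
  have hW := polyGrowth_squareDiff s r ((1 + ρ) / 2) (c / 2) ((1 - ρ) / 2) (-c / 2)
  set P := affineForm r ((1 + ρ) / 2) (c / 2)
  set Q := affineForm 0 ((1 - ρ) / 2) (-c / 2)
  have hWPQ : ∀ p, squareDiff s r ((1 + ρ) / 2) (c / 2) ((1 - ρ) / 2) (-c / 2) p
    = s * (P p ^ 2 - Q p ^ 2) := fun p => rfl
  set W := squareDiff s r ((1 + ρ) / 2) (c / 2) ((1 - ρ) / 2) (-c / 2)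
  rw [integral_map hW.1.aemeasurable hA2.aestronglyMeasurable]
  have hWI : ∀ m ≤ 3, ∫ p, W p * iteratedDeriv m f (W p) ∂γ₂
      = s * (∫ p, P p ^ 2 * iteratedDeriv m f (W p) ∂γ₂
        - ∫ p, Q p ^ 2 * iteratedDeriv m f (W p) ∂γ₂) := by
    intro m hm
    rw [← integral_sub ((hP.pow 2).mul (hgrow m hm hW)).integrable
      ((hQ.pow 2).mul (hgrow m hm hW)).integrable, ← integral_const_mul]
    congr 1
    ext p
    linear_combination (iteratedDeriv m f (W p)) * hWPQ p
  have hI : ∀ m ≤ 3, Integrable (fun p => iteratedDeriv m f (W p)) γ₂ :=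
    fun m hm => (hgrow m hm hW).integrable
  have hIW : ∀ m ≤ 3, Integrable (fun p => W p * iteratedDeriv m f (W p)) γ₂ :=
    fun m hm => (hW.mul (hgrow m hm hW)).integrable
  have hI0 := hI 0 (by norm_num)
  have hI1 := hI 1 (by norm_num)
  have hI2 := hI 2 (by norm_num)
  have hIW0 := hIW 0 (by norm_num)
  have hIW1 := hIW 1 (by norm_num)
  have hIW2 := hIW 2 (by norm_num)
  have hIW3 := hIW 3 (by norm_num)
  have hsplit : (fun p => A2 1 μX μY σX σY ρ f (W p)) = fun p =>
      s ^ 3 * (1 - ρ ^ 2) * (1 + ρ) * (W p * iteratedDeriv 3 f (W p))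
        + (s ^ 2 * (1 + ρ) * (3 * ρ - 1) * (W p * iteratedDeriv 2 f (W p))
        + (-(s * (3 * ρ + 1)) * (W p * iteratedDeriv 1 f (W p))
        + (W p * iteratedDeriv 0 f (W p)
        + (s ^ 3 * (1 + ρ) * (1 - ρ ^ 2) * iteratedDeriv 2 f (W p)
        + (s ^ 2 * (2 * ρ ^ 2 + ρ - 1 - (1 - ρ) * r * r) * iteratedDeriv 1 f (W p)
        + -(s * ρ + s * r * r) * iteratedDeriv 0 f (W p)))))) := by
    ext p
    simp only [A2, Nat.cast_one, div_one, ← hs_def, hμ, ← heq, one_mul, iteratedDeriv_zero]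
    ring
  rw [hsplit, integral_add, integral_add, integral_add, integral_add, integral_add, integral_add]
  · simp only [integral_const_mul]
    rw [hWI 0 (by norm_num), hWI 1 (by norm_num), hWI 2 (by norm_num), hWI 3 (by norm_num)]
    have L10 := L1 0 (by norm_num)
    have L11 := L1 1 (by norm_num)
    have L12 := L1 2 (by norm_num)
    have L20 := L2 0 (by norm_num)
    have L21 := L2 1 (by norm_num)
    have L22 := L2 2 (by norm_num)
    have L30 := L3 0 (by norm_num)
    have L31 := L3 1 (by norm_num)
    have L32 := L3 2 (by norm_num)
    norm_num only at L10 L11 L12 L20 L21 L22 L30 L31 L32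
    linear_combination s * (L20 - s * (2 * ρ) * L21 - s ^ 2 * (1 + ρ) * (1 - ρ) * L22)
      + s * r * (L10 + s * (1 - ρ) * L11)
      - s * (L30 - 2 * s * (1 + ρ) * L31 + s ^ 2 * (1 + ρ) ^ 2 * L32)
  all_goals fun_prop

lemma tendsto_integral_mul_comp_dilation {μ : Measure ℝ} {g φ : ℝ → ℝ} (hg : Integrable g μ)
    (hφ : Continuous φ) {C : ℝ} (hC : ∀ x, |φ x| ≤ C) {ε : ℕ → ℝ}
    (hε : Filter.Tendsto ε Filter.atTop (nhds 0)) :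
    Filter.Tendsto (fun N => ∫ x, φ (ε N * x) * g x ∂μ) Filter.atTop
      (nhds (φ 0 * ∫ x, g x ∂μ)) := by
  rw [← integral_const_mul]
  refine tendsto_integral_of_dominated_convergence (fun x => C * |g x|)
    (fun N => ((by fun_prop : Continuous fun x => φ (ε N * x)).aestronglyMeasurable).mul
      hg.aestronglyMeasurable) (hg.abs.const_mul C) (fun N => ?_) ?_
  · refine Filter.Eventually.of_forall fun x => ?_
    rw [Real.norm_eq_abs, abs_mul]
    exact mul_le_mul_of_nonneg_right (hC _) (abs_nonneg _)
  · refine Filter.Eventually.of_forall fun x => ?_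
    have h : Filter.Tendsto (fun N => ε N * x) Filter.atTop (nhds 0) := by
      simpa using hε.mul_const x
    exact ((hφ.tendsto 0).comp h).mul_const _

/-- The Leibniz expansion of `A2` on the product of `f` with a dilated cutoff. -/
lemma A2_mul_comp_dilation (μX μY σX σY ρ : ℝ) {f χ : ℝ → ℝ} (hf : ContDiff ℝ 3 f)
    (hχ : ContDiff ℝ 3 χ) (ε x : ℝ) :
    A2 1 μX μY σX σY ρ (fun y => χ (ε * y) * f y) x
      = χ (ε * x) * A2 1 μX μY σX σY ρ f x
        + ε * (iteratedDeriv 1 χ (ε * x)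
          * (3 * ((σX * σY) ^ 3 * (1 - ρ ^ 2) * (1 + ρ)) * (x * iteratedDeriv 2 f x)
            + (2 * ((σX * σY) ^ 3 * (1 + ρ) * (1 - ρ ^ 2)) * iteratedDeriv 1 f x
            + (2 * ((σX * σY) ^ 2 * (1 + ρ) * (3 * ρ - 1)) * (x * iteratedDeriv 1 f x)
            + ((σX * σY) ^ 2 * (2 * ρ ^ 2 + ρ - 1 - (1 - ρ) * (μX / σX) * (μY / σY))
              * iteratedDeriv 0 f x
            + -(σX * σY * (3 * ρ + 1)) * (x * iteratedDeriv 0 f x))))))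
        + ε ^ 2 * (iteratedDeriv 2 χ (ε * x)
          * (3 * ((σX * σY) ^ 3 * (1 - ρ ^ 2) * (1 + ρ)) * (x * iteratedDeriv 1 f x)
            + ((σX * σY) ^ 3 * (1 + ρ) * (1 - ρ ^ 2) * iteratedDeriv 0 f x
            + (σX * σY) ^ 2 * (1 + ρ) * (3 * ρ - 1) * (x * iteratedDeriv 0 f x))))
        + ε ^ 3 * (iteratedDeriv 3 χ (ε * x)
          * ((σX * σY) ^ 3 * (1 - ρ ^ 2) * (1 + ρ) * (x * iteratedDeriv 0 f x))) := by
  have hχε : ContDiff ℝ 3 fun y => χ (ε * y) := hχ.comp (contDiff_const.mul contDiff_id)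
  have hleib : ∀ m ≤ 3, iteratedDeriv m (fun y => χ (ε * y) * f y) x
      = ∑ i ∈ Finset.range (m + 1),
        (m.choose i : ℝ) * (ε ^ i * iteratedDeriv i χ (ε * x)) * iteratedDeriv (m - i) f x := by
    intro m hm
    have hm' : (m : WithTop ℕ∞) ≤ 3 := by exact_mod_cast hm
    rw [iteratedDeriv_fun_mul (hχε.of_le hm').contDiffAt (hf.of_le hm').contDiffAt]
    refine Finset.sum_congr rfl fun i hi => ?_
    have hi' : (i : WithTop ℕ∞) ≤ 3 := by
      exact_mod_cast (Nat.lt_succ_iff.1 (Finset.mem_range.1 hi)).trans hm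
    rw [iteratedDeriv_comp_const_mul (hχ.of_le hi')]
  simp only [A2, hleib 3 le_rfl, hleib 2 (by norm_num), hleib 1 (by norm_num),
    Finset.sum_range_succ, Finset.sum_range_zero, Nat.choose, iteratedDeriv_zero, Nat.cast_one,
    div_one]
  norm_num
  ring

/-- Necessity part of the third-order Stein characterisation in the case `μX/σX = μY/σY`,
for `Z ∼ PN(μX, μY; σX², σY²; ρ)`: for every `C³` function `f` with `E|f⁽ᵐ⁾(Z)| < ∞` for
`m = 0,1,2` and `E|Z f⁽ᵐ⁾(Z)| < ∞` for `m = 0,1,2,3`, one has `E[A₂ f (Z)] = 0` (with `n = 1`). -/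
theorem stein_necessity_third_order_PN
    (μX μY σX σY ρ : ℝ) (hσX : 0 < σX) (hσY : 0 < σY)
    (hρ₁ : -1 < ρ) (hρ₂ : ρ < 1) (heq : μX / σX = μY / σY)
    (f : ℝ → ℝ) (hf : ContDiff ℝ 3 f)
    (hint : ∀ m ≤ 2, Integrable (iteratedDeriv m f) (PN μX μY σX σY ρ))
    (hintx : ∀ m ≤ 3, Integrable (fun x => x * iteratedDeriv m f x) (PN μX μY σX σY ρ)) :
    ∫ x, A2 1 μX μY σX σY ρ f x ∂(PN μX μY σX σY ρ) = 0 := by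
  have hρ : 0 ≤ 1 - ρ ^ 2 := by nlinarith
  let χ : ContDiffBump (0 : ℝ) := default
  have hχ : ContDiff ℝ 3 χ := χ.contDiff
  have hχs : HasCompactSupport χ := χ.hasCompactSupport
  have hχ0 : iteratedDeriv 0 χ 0 = 1 := by
    rw [iteratedDeriv_zero]
    exact χ.one_of_mem_closedBall (by simpa using χ.rIn_pos.le)
  have hχc : ∀ m ≤ 3, Continuous (iteratedDeriv m χ) := fun m hm =>
    hχ.continuous_iteratedDeriv m (by exact_mod_cast hm)
  let ε : ℕ → ℝ := fun N => 1 / ((N : ℝ) + 1)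
  have hε : Filter.Tendsto ε Filter.atTop (nhds 0) := tendsto_one_div_add_atTop_nhds_zero_nat
  have hε0 : ∀ N, ε N ≠ 0 := fun N => by positivity
  have hlim : ∀ m ≤ 3, ∀ {g : ℝ → ℝ}, Integrable g (PN μX μY σX σY ρ) →
      Filter.Tendsto (fun N => ∫ x, iteratedDeriv m χ (ε N * x) * g x ∂(PN μX μY σX σY ρ))
        Filter.atTop (nhds (iteratedDeriv m χ 0 * ∫ x, g x ∂(PN μX μY σX σY ρ))) := by
    intro m hm g hg
    obtain ⟨C, hC⟩ := (hχs.iteratedDeriv m).exists_bound_of_continuous (hχc m hm)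
    exact tendsto_integral_mul_comp_dilation hg (hχc m hm) hC hε
  have hmul : ∀ m ≤ 3, ∀ N, ∀ {g : ℝ → ℝ}, Integrable g (PN μX μY σX σY ρ) →
      Integrable (fun x => iteratedDeriv m χ (ε N * x) * g x) (PN μX μY σX σY ρ) := by
    intro m hm N g hg
    obtain ⟨C, hC⟩ := (hχs.iteratedDeriv m).exists_bound_of_continuous (hχc m hm)
    have hc := hχc m hm
    exact hg.bdd_mul (c := C) (by fun_prop) (Filter.Eventually.of_forall fun x => hC _)
  have hi0 := hint 0 (by norm_num)
  have hi1 := hint 1 (by norm_num)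
  have hi2 := hint 2 (by norm_num)
  have hx0 := hintx 0 (by norm_num)
  have hx1 := hintx 1 (by norm_num)
  have hx2 := hintx 2 (by norm_num)
  have hx3 := hintx 3 (by norm_num)
  have hA2 : Integrable (A2 1 μX μY σX σY ρ f) (PN μX μY σX σY ρ) := by
    have : A2 1 μX μY σX σY ρ f = fun x =>
        (σX * σY) ^ 3 * (1 - ρ ^ 2) * (1 + ρ) * (x * iteratedDeriv 3 f x)
        + ((σX * σY) ^ 3 * (1 + ρ) * (1 - ρ ^ 2) * iteratedDeriv 2 f x
        + ((σX * σY) ^ 2 * (1 + ρ) * (3 * ρ - 1) * (x * iteratedDeriv 2 f x)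
        + ((σX * σY) ^ 2 * (2 * ρ ^ 2 + ρ - 1 - (1 - ρ) * (μX / σX) * (μY / σY))
          * iteratedDeriv 1 f x
        + (-(σX * σY * (3 * ρ + 1)) * (x * iteratedDeriv 1 f x)
        + (x * iteratedDeriv 0 f x
        + -(σX * σY * ρ + μX * μY) * iteratedDeriv 0 f x))))) := by
      ext x
      simp only [A2, Nat.cast_one, div_one, one_mul, iteratedDeriv_zero]
      ring
    rw [this]
    fun_prop
  have key : ∀ {g₁ g₂ g₃ : ℝ → ℝ}, Integrable g₁ (PN μX μY σX σY ρ) →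
      Integrable g₂ (PN μX μY σX σY ρ) → Integrable g₃ (PN μX μY σX σY ρ) →
      (∀ N x, A2 1 μX μY σX σY ρ (fun y => χ (ε N * y) * f y) x
        = iteratedDeriv 0 χ (ε N * x) * A2 1 μX μY σX σY ρ f x
          + ε N * (iteratedDeriv 1 χ (ε N * x) * g₁ x)
          + ε N ^ 2 * (iteratedDeriv 2 χ (ε N * x) * g₂ x)
          + ε N ^ 3 * (iteratedDeriv 3 χ (ε N * x) * g₃ x)) →
      ∫ x, A2 1 μX μY σX σY ρ f x ∂(PN μX μY σX σY ρ) = 0 := by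
    intro g₁ g₂ g₃ h₁ h₂ h₃ hexp
    have ht := (((hlim 0 (by norm_num) hA2).add (hε.mul (hlim 1 (by norm_num) h₁))).add
      ((hε.pow 2).mul (hlim 2 (by norm_num) h₂))).add ((hε.pow 3).mul (hlim 3 le_rfl h₃))
    have hz : ∀ N, (∫ x, iteratedDeriv 0 χ (ε N * x) * A2 1 μX μY σX σY ρ f x
          ∂(PN μX μY σX σY ρ))
        + ε N * (∫ x, iteratedDeriv 1 χ (ε N * x) * g₁ x ∂(PN μX μY σX σY ρ))
        + ε N ^ 2 * (∫ x, iteratedDeriv 2 χ (ε N * x) * g₂ x ∂(PN μX μY σX σY ρ))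
        + ε N ^ 3 * (∫ x, iteratedDeriv 3 χ (ε N * x) * g₃ x ∂(PN μX μY σX σY ρ)) = 0 := by
      intro N
      have hcs : HasCompactSupport fun y => χ (ε N * y) * f y :=
        (hχs.comp_homeomorph (Homeomorph.mulLeft₀ (ε N) (hε0 N))).mul_right
      have h0 : ∫ x, A2 1 μX μY σX σY ρ (fun y => χ (ε N * y) * f y) x ∂(PN μX μY σX σY ρ) = 0 :=
        integral_A2_of_hasCompactSupport hσX hσY hρ heq
          ((hχ.comp (contDiff_const.mul contDiff_id)).mul hf) hcs
      have m0 := hmul 0 (by norm_num) N hA2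
      have m1 := (hmul 1 (by norm_num) N h₁).const_mul (ε N)
      have m2 := (hmul 2 (by norm_num) N h₂).const_mul (ε N ^ 2)
      have m3 := (hmul 3 le_rfl N h₃).const_mul (ε N ^ 3)
      rw [integral_congr_ae (Filter.Eventually.of_forall (hexp N)), integral_add, integral_add,
        integral_add, integral_const_mul, integral_const_mul, integral_const_mul] at h0
      · exact h0
      exacts [m0, m1, m0.add m1, m2, (m0.add m1).add m2, m3]
    have := tendsto_nhds_unique ht ((Filter.tendsto_congr hz).2 tendsto_const_nhds)
    simpa [hχ0] using this
  refine key ?_ ?_ ?_ fun N x => by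
    rw [iteratedDeriv_zero]
    exact A2_mul_comp_dilation μX μY σX σY ρ hf hχ (ε N) x
  all_goals fun_prop
end
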